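/- Uniform asymptotics of the Tricomi function along the upper imaginary direction (equation (4.9) in the proof of Theorem 4.2): Let a>0, σ>0, κ>0, j∈{0,1} with 2a/σ² ∉ ℤ, and let K be a compact subset of (0,∞). Then, as u→+∞, U((1+iu)/κ + j, 2a/σ² + j, 2κv/σ²) ∼ (√π / Γ((1+iu)/κ + j)) · exp( κv/σ² − 2·√( (2κv/σ²)·((1+iu)/κ + j) ) ) · (2κv/σ²)^{1/4 − a/σ² − j/2} · ((1+iu)/κ + j)^{−3/4 + a/σ² + j/2}, uniformly for v∈K; that is, the ratio of the left-hand side to the right-hand side tends to 1 uniformly in v∈K as u→+∞. -/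

import Mathlib

open Filter

noncomputable section

/-- Kummer confluent hypergeometric function `₁F₁(x, b, y)`. -/
def hyp1F1 (x b y : ℂ) : ℂ :=
  ∑' n : ℕ, (Polynomial.eval x (ascPochhammer ℂ n)
      / (Polynomial.eval b (ascPochhammer ℂ n) * (n.factorial : ℂ))) * y ^ n

/-- Tricomi confluent hypergeometric function `U(a, b, z)` (principal branch). -/
def tricomiU (a b z : ℂ) : ℂ :=
  Complex.Gamma (1 - b) / Complex.Gamma (1 + a - b) * hyp1F1 a b z
    + Complex.Gamma (b - 1) / Complex.Gamma a * z ^ (1 - b) * hyp1F1 (1 + a - b) (2 - b) z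

section helpers

open MeasureTheory Set Topology

/-- coefficient bound of exponential type -/
def CoefBd (c : ℕ → ℂ) : Prop :=
  ∃ C K : ℝ, 0 ≤ C ∧ 0 ≤ K ∧ ∀ n, ‖c n‖ ≤ C * K ^ n / (n.factorial : ℝ)

def shiftC (c : ℕ → ℂ) : ℕ → ℂ := fun n => ((n : ℂ) + 1) * c (n + 1)

def ps (c : ℕ → ℂ) (z : ℂ) : ℂ := ∑' n, c n * z ^ n

lemma CoefBd.shift {c : ℕ → ℂ} (h : CoefBd c) : CoefBd (shiftC c) := by
  obtain ⟨C, K, hC, hK, h⟩ := h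
  refine ⟨C * K, K, by positivity, hK, fun n => ?_⟩
  have h1 := h (n + 1)
  have h2 : ‖(n : ℂ) + 1‖ = (n : ℝ) + 1 := by
    have : ((n : ℂ) + 1) = ((n + 1 : ℕ) : ℂ) := by push_cast; ring
    rw [this, Complex.norm_natCast]; push_cast; ring
  unfold shiftC
  rw [norm_mul, h2]
  calc ((n : ℝ) + 1) * ‖c (n + 1)‖ ≤ ((n : ℝ) + 1) * (C * K ^ (n + 1) / ((n + 1).factorial : ℝ)) := by
        gcongr
    _ = C * K * K ^ n / (n.factorial : ℝ) := by
        rw [Nat.factorial_succ]; push_cast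
        have : (n.factorial : ℝ) ≠ 0 := by positivity
        have : (n : ℝ) + 1 ≠ 0 := by positivity
        field_simp
        ring

lemma CoefBd.summable {c : ℕ → ℂ} (h : CoefBd c) (z : ℂ) : Summable (fun n => c n * z ^ n) := by
  obtain ⟨C, K, hC, hK, h⟩ := h
  refine Summable.of_norm_bounded (g := fun n => C * ((K * ‖z‖) ^ n / (n.factorial : ℝ))) ?_ ?_
  · exact (Real.summable_pow_div_factorial _).mul_left _
  · intro n
    rw [norm_mul, norm_pow, mul_pow]
    calc ‖c n‖ * ‖z‖ ^ n ≤ (C * K ^ n / (n.factorial : ℝ)) * ‖z‖ ^ n := by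
          gcongr; exact h n
      _ = _ := by ring

lemma ps_hasDerivAt {c : ℕ → ℂ} (h : CoefBd c) (z : ℂ) :
    HasDerivAt (ps c) (ps (shiftC c) z) z := by
  have hs := h.shift.summable
  have h0 := h
  obtain ⟨C, K, hC, hK, h⟩ := h
  set R : ℝ := ‖z‖ + 1 with hR
  have hRpos : 0 < R := by positivity
  let u : ℕ → ℝ := fun n => (C * K ^ n / (n.factorial : ℝ)) * (n * R ^ (n - 1))
  have hu : Summable u := by
    rw [← summable_nat_add_iff 1]
    refine ((Real.summable_pow_div_factorial (K * R)).mul_left (C * K)).congr ?_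
    intro n
    simp only [u]
    rw [Nat.factorial_succ]; push_cast
    have : (n.factorial : ℝ) ≠ 0 := by positivity
    have : (n : ℝ) + 1 ≠ 0 := by positivity
    field_simp
    ring
  have key := hasDerivAt_tsum_of_isPreconnected (𝕜 := ℂ) (F := ℂ) (u := u)
    (g := fun n y => c n * y ^ n) (g' := fun n y => c n * (n * y ^ (n - 1)))
    (t := Metric.ball 0 R) (y₀ := 0) (y := z) hu Metric.isOpen_ball
    (convex_ball _ _).isPreconnected ?_ ?_ (by simpa using hRpos) (h0.summable 0)
    (by simp [hR])
  · have e : (∑' n, c n * ((n : ℂ) * z ^ (n - 1))) = ps (shiftC c) z := by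
      have hsum : Summable (fun n : ℕ => c n * ((n : ℂ) * z ^ (n - 1))) := by
        rw [← summable_nat_add_iff 1]
        refine (hs z).congr ?_
        intro n; simp only [shiftC, Nat.add_sub_cancel]; push_cast; ring
      rw [hsum.tsum_eq_zero_add]
      simp only [Nat.cast_zero, zero_mul, mul_zero, zero_add, ps]
      refine tsum_congr fun n => ?_
      simp only [shiftC, Nat.add_sub_cancel]; push_cast; ring
    rw [e] at key
    exact key
  · intro n y hy
    exact (hasDerivAt_pow n y).const_mul (c n)
  · intro n y hy
    have hy' : ‖y‖ ≤ R := by simpa using (Metric.mem_ball.1 hy).le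
    rw [norm_mul, norm_mul, norm_pow, Complex.norm_natCast]
    simp only [u]
    gcongr
    exact h n

/-- coefficients of the Kummer series -/
def kc (x b : ℂ) (n : ℕ) : ℂ := Polynomial.eval x (ascPochhammer ℂ n)
      / (Polynomial.eval b (ascPochhammer ℂ n) * (n.factorial : ℂ))

lemma hyp_eq_ps (x b y : ℂ) : hyp1F1 x b y = ps (kc x b) y := rfl

lemma asc_ne {b : ℂ} (hb : ∀ n : ℕ, b + n ≠ 0) (n : ℕ) :
    Polynomial.eval b (ascPochhammer ℂ n) ≠ 0 := by
  induction n with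
  | zero => simp
  | succ n ih => rw [ascPochhammer_succ_eval]; exact mul_ne_zero ih (hb n)

lemma kc_zero (x b : ℂ) : kc x b 0 = 1 := by simp [kc]

lemma kc_rec (x : ℂ) {b : ℂ} (hb : ∀ n : ℕ, b + n ≠ 0) (n : ℕ) :
    ((n : ℂ) + 1) * (b + n) * kc x b (n + 1) = (x + n) * kc x b n := by
  have h1 := asc_ne hb n
  have h2 := hb n
  have h3 : (n.factorial : ℂ) ≠ 0 := by exact_mod_cast n.factorial_ne_zero
  have h4 : (n : ℂ) + 1 ≠ 0 := by exact_mod_cast n.succ_ne_zero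
  unfold kc
  rw [ascPochhammer_succ_eval, ascPochhammer_succ_eval, Nat.factorial_succ]
  push_cast
  field_simp

lemma kc_rec' (x : ℂ) {b : ℂ} (hb : ∀ n : ℕ, b + n ≠ 0) (n : ℕ) :
    shiftC (kc x b) n = (x + n) / (b + n) * kc x b n := by
  have := kc_rec x hb n
  have h2 := hb n
  unfold shiftC
  field_simp
  linear_combination this

lemma kc_bd (x : ℂ) {b : ℂ} (hb : ∀ n : ℕ, b + n ≠ 0) : CoefBd (kc x b) := by
  have ht : Tendsto (fun n : ℕ => (x + n) / (b + n)) atTop (nhds 1) := by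
    have h1 : Tendsto (fun n : ℕ => (x - b) / (b + n)) atTop (nhds 0) := by
      have h3 : Tendsto (fun n : ℕ => ‖b + n‖) atTop atTop := by
        refine tendsto_atTop_mono (f := fun n : ℕ => (n : ℝ) + (-‖b‖)) (fun n => ?_)
          (tendsto_atTop_add_const_right _ _ tendsto_natCast_atTop_atTop)
        have := norm_sub_le (b + n) b
        rw [add_sub_cancel_left, Complex.norm_natCast] at this
        linarith
      refine tendsto_zero_iff_norm_tendsto_zero.2 ?_
      simp only [norm_div]
      exact h3.const_div_atTop _
    have h2 := h1.const_add 1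
    rw [add_zero] at h2
    refine h2.congr fun n => ?_
    have := hb n
    field_simp
    ring
  obtain ⟨K, hK⟩ := (ht.norm).bddAbove_range
  have hK' : ∀ n : ℕ, ‖(x + n) / (b + n)‖ ≤ K := fun n => hK ⟨n, rfl⟩
  have hK0 : 0 ≤ K := (norm_nonneg _).trans (hK' 0)
  refine ⟨1, K, zero_le_one, hK0, fun n => ?_⟩
  rw [one_mul]
  induction n with
  | zero => simp [kc_zero]
  | succ n ih =>
    have h4 : (n : ℂ) + 1 ≠ 0 := by exact_mod_cast n.succ_ne_zero
    have h5 : ‖(n : ℂ) + 1‖ = (n : ℝ) + 1 := by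
      have : ((n : ℂ) + 1) = ((n + 1 : ℕ) : ℂ) := by push_cast; ring
      rw [this, Complex.norm_natCast]; push_cast; ring
    have e : kc x b (n + 1) = (x + n) / (b + n) * kc x b n / ((n : ℂ) + 1) := by
      rw [← kc_rec' x hb n]; unfold shiftC; field_simp
    rw [e, norm_div, norm_mul, h5, Nat.factorial_succ]
    push_cast
    calc ‖(x + n) / (b + n)‖ * ‖kc x b n‖ / ((n : ℝ) + 1)
        ≤ K * (K ^ n / (n.factorial : ℝ)) / ((n : ℝ) + 1) := by
          gcongr; exact hK' n
      _ = K ^ (n + 1) / (((n : ℝ) + 1) * (n.factorial : ℝ)) := by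
          have : (n.factorial : ℝ) ≠ 0 := by positivity
          have : (n : ℝ) + 1 ≠ 0 := by positivity
          field_simp
          ring

lemma ps_zero (c : ℕ → ℂ) : ps c 0 = c 0 := by
  unfold ps
  rw [tsum_eq_single 0]
  · simp
  · intro n hn; simp [hn]

lemma z_mul_ps {c : ℕ → ℂ} (h : CoefBd c) (z : ℂ) :
    ps (fun n : ℕ => (n : ℂ) * c n) z = z * ps (shiftC c) z := by
  have hs : Summable (fun n : ℕ => ((n : ℂ) * c n) * z ^ n) := by
    rw [← summable_nat_add_iff 1]
    refine ((h.shift.summable z).mul_left z).congr fun n => ?_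
    simp only [shiftC]; push_cast; ring
  unfold ps
  rw [hs.tsum_eq_zero_add, ← tsum_mul_left]
  simp only [Nat.cast_zero, zero_mul, zero_add]
  refine tsum_congr fun n => ?_
  simp only [shiftC]; push_cast; ring

lemma nmul_summable {c : ℕ → ℂ} (h : CoefBd c) (z : ℂ) :
    Summable (fun n : ℕ => ((n : ℂ) * c n) * z ^ n) := by
  rw [← summable_nat_add_iff 1]
  refine ((h.shift.summable z).mul_left z).congr fun n => ?_
  simp only [shiftC]; push_cast; ring

/-- Kummer ODE for the Kummer series -/
lemma kummer_ode (x : ℂ) {b : ℂ} (hb : ∀ n : ℕ, b + n ≠ 0) (z : ℂ) :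
    z * ps (shiftC (shiftC (kc x b))) z + (b - z) * ps (shiftC (kc x b)) z
      - x * ps (kc x b) z = 0 := by
  have hc := kc_bd x hb
  rw [sub_mul, ← z_mul_ps hc.shift z, ← z_mul_ps hc z]
  unfold ps
  have s1 := (nmul_summable hc.shift z).hasSum
  have s2 := (hc.shift.summable z).hasSum.mul_left b
  have s3 := (nmul_summable hc z).hasSum
  have s4 := (hc.summable z).hasSum.mul_left x
  have s := (s1.add (s2.sub s3)).sub s4
  have e : ∀ n : ℕ, (n : ℂ) * shiftC (kc x b) n * z ^ n + (b * (shiftC (kc x b) n * z ^ n)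
      - (n : ℂ) * kc x b n * z ^ n) - x * (kc x b n * z ^ n) = 0 := by
    intro n
    have := kc_rec x hb n
    unfold shiftC
    linear_combination z ^ n * this
  simp only [e] at s
  exact s.unique hasSum_zero

lemma hasSum_congr_aux {f g : ℕ → ℂ} {S : ℂ} (h : ∀ n, f n = g n) (hg : HasSum g S) :
    HasSum f S := by
  have : f = g := funext h
  rw [this]; exact hg

lemma kc_add_one (x : ℂ) {b : ℂ} (hb : ∀ n : ℕ, b + n ≠ 0) (n : ℕ) :
    (b + n) * kc x (b + 1) n = b * kc x b n := by
  have hb1 : ∀ n : ℕ, b + 1 + n ≠ 0 := fun n => by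
    have := hb (n + 1); push_cast at this; convert this using 1; ring
  induction n with
  | zero => simp [kc_zero]
  | succ n ih =>
    have r1 := kc_rec x hb n
    have r2 := kc_rec x hb1 n
    have h4 : (n : ℂ) + 1 ≠ 0 := by exact_mod_cast n.succ_ne_zero
    have h5 := hb n
    apply mul_left_cancel₀ (mul_ne_zero h4 h5)
    push_cast
    linear_combination (b + n) * r2 - b * r1 + (x + n) * ih

lemma kummer_contig1 (x : ℂ) {b : ℂ} (hb : ∀ n : ℕ, b + n ≠ 0) (z : ℂ) :
    b * (ps (kc x b) z - ps (shiftC (kc x b)) z) = (b - x) * ps (kc x (b + 1)) z := by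
  have hb1 : ∀ n : ℕ, b + 1 + n ≠ 0 := fun n => by
    have := hb (n + 1); push_cast at this; convert this using 1; ring
  have hc := kc_bd x hb
  have s1 := (((hc.summable z).hasSum.sub (hc.shift.summable z).hasSum).mul_left b)
  have s2 := (((kc_bd x hb1).summable z).hasSum.mul_left (b - x))
  unfold ps
  refine s1.unique ?_
  refine hasSum_congr_aux (fun n => ?_) s2
  rw [kc_rec' x hb n]
  have h5 := hb n
  have := kc_add_one x hb n
  have e : kc x (b + 1) n = b * kc x b n / (b + n) := by field_simp; linear_combination this
  rw [e]
  field_simp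
  ring

lemma asc_left (x : ℂ) (n : ℕ) : Polynomial.eval x (ascPochhammer ℂ (n + 1)) =
    x * Polynomial.eval (x + 1) (ascPochhammer ℂ n) := by
  rw [ascPochhammer_succ_left]; simp

lemma kummer_contig2 (x : ℂ) {b : ℂ} (hb : ∀ n : ℕ, b + n ≠ 0) (z : ℂ) :
    z * ps (kc (x + 1) (b + 1)) z - b * ps (kc (x + 1) (b + 1)) z
      - z * ps (shiftC (kc (x + 1) (b + 1))) z = - b * ps (kc x b) z := by
  have hb1 : ∀ n : ℕ, b + 1 + n ≠ 0 := fun n => by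
    have := hb (n + 1); push_cast at this; convert this using 1; ring
  have hc := kc_bd (x + 1) hb1
  rw [← z_mul_ps hc z]
  have s0 : HasSum (fun n : ℕ => (if n = 0 then 0 else kc (x + 1) (b + 1) (n - 1)) * z ^ n)
      (z * ps (kc (x + 1) (b + 1)) z) := by
    rw [← hasSum_nat_add_iff' 1]
    rw [Finset.range_one, Finset.sum_singleton, if_pos rfl, zero_mul, sub_zero]
    refine hasSum_congr_aux (fun n => ?_) ((hc.summable z).hasSum.mul_left z)
    rw [if_neg (Nat.succ_ne_zero n), Nat.add_sub_cancel]; ring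
  have s1 := (hc.summable z).hasSum.mul_left b
  have s2 := (nmul_summable hc z).hasSum
  have s3 := ((kc_bd x hb).summable z).hasSum.mul_left (-b)
  refine ((s0.sub s1).sub s2).unique ?_
  refine hasSum_congr_aux (fun n => ?_) s3
  cases n with
  | zero => simp [kc_zero]
  | succ n =>
    have r := kc_rec (x + 1) hb1 n
    have h1 := asc_ne hb1 n
    have h3 : (n.factorial : ℂ) ≠ 0 := by exact_mod_cast n.factorial_ne_zero
    have h4 : (n : ℂ) + 1 ≠ 0 := by exact_mod_cast n.succ_ne_zero
    have hb0 : b ≠ 0 := by simpa using hb 0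
    have e : b * ((n : ℂ) + 1) * kc x b (n + 1) = x * kc (x + 1) (b + 1) n := by
      unfold kc
      rw [asc_left, asc_left, Nat.factorial_succ]
      push_cast
      field_simp
    simp only [Nat.succ_ne_zero, if_false, Nat.add_sub_cancel]
    apply mul_left_cancel₀ h4
    push_cast
    linear_combination (-z ^ (n + 1)) * r + z ^ (n + 1) * e


/-- Laplace-type integral. -/
def LI (p q : ℂ) (z : ℝ) : ℂ :=
  ∫ t in Ioi (0 : ℝ), Complex.exp (-(z * t : ℝ)) * (t : ℂ) ^ (p - 1) * ((1 + t : ℝ) : ℂ) ^ q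

lemma li_norm (p q : ℂ) (z : ℝ) {t : ℝ} (ht : 0 < t) :
    ‖Complex.exp (-(z * t : ℝ)) * (t : ℂ) ^ (p - 1) * ((1 + t : ℝ) : ℂ) ^ q‖
      = Real.exp (-(z * t)) * t ^ (p.re - 1) * (1 + t) ^ q.re := by
  rw [norm_mul, norm_mul, Complex.norm_cpow_eq_rpow_re_of_pos ht,
    Complex.norm_cpow_eq_rpow_re_of_pos (by linarith), Complex.norm_exp]
  simp

lemma one_add_rpow_le {β c : ℝ} (hc : 0 < c) :
    ∃ C : ℝ, 0 < C ∧ ∀ t : ℝ, 0 ≤ t → (1 + t) ^ β ≤ C * Real.exp (c * t) := by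
  set m : ℝ := |β| + 1 with hm
  have hmpos : 0 < m := by positivity
  set ε : ℝ := min 1 (c / m) with hε
  have hεpos : 0 < ε := lt_min one_pos (by positivity)
  have hε1 : ε ≤ 1 := min_le_left _ _
  have hε2 : ε * m ≤ c := by
    calc ε * m ≤ c / m * m := by gcongr; exact min_le_right _ _
      _ = c := by field_simp
  refine ⟨(1 / ε) ^ m, by positivity, fun t ht => ?_⟩
  have h1 : 1 + t ≤ 1 / ε * Real.exp (ε * t) := by
    have := Real.add_one_le_exp (ε * t)
    rw [div_mul_eq_mul_div, le_div_iff₀ hεpos]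
    nlinarith
  calc (1 + t) ^ β ≤ (1 + t) ^ m := by
        apply Real.rpow_le_rpow_of_exponent_le (by linarith)
        have := le_abs_self β; linarith
    _ ≤ (1 / ε * Real.exp (ε * t)) ^ m := by
        apply Real.rpow_le_rpow (by linarith) h1 hmpos.le
    _ = (1 / ε) ^ m * Real.exp (ε * m * t) := by
        rw [Real.mul_rpow (by positivity) (Real.exp_pos _).le, ← Real.exp_mul]
        ring_nf
    _ ≤ (1 / ε) ^ m * Real.exp (c * t) := by gcongr

lemma li_real_int {α β c : ℝ} (hα : 0 < α) (hc : 0 < c) :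
    IntegrableOn (fun t : ℝ => Real.exp (-(c * t)) * t ^ (α - 1) * (1 + t) ^ β) (Ioi 0) := by
  obtain ⟨C, hC, hb⟩ := one_add_rpow_le (β := β) (half_pos hc)
  have h1 : IntegrableOn (fun t : ℝ => C * (t ^ (α - 1) * Real.exp (-(c / 2) * t))) (Ioi 0) := by
    refine Integrable.const_mul ?_ C
    have := integrableOn_rpow_mul_exp_neg_mul_rpow (s := α - 1) (p := 1) (b := c / 2)
      (by linarith) one_pos (by positivity)
    simpa [IntegrableOn] using this
  refine Integrable.mono' h1 ?_ ?_
  · apply Measurable.aestronglyMeasurable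
    fun_prop
  · refine (ae_restrict_iff' measurableSet_Ioi).2 (Eventually.of_forall fun t ht => ?_)
    have ht : 0 < t := ht
    have hp : 0 < t ^ (α - 1) := Real.rpow_pos_of_pos ht _
    have hq : 0 < (1 + t) ^ β := Real.rpow_pos_of_pos (by linarith) _
    rw [Real.norm_of_nonneg (by positivity)]
    calc Real.exp (-(c * t)) * t ^ (α - 1) * (1 + t) ^ β
        ≤ Real.exp (-(c * t)) * t ^ (α - 1) * (C * Real.exp (c / 2 * t)) := by
          gcongr; exact hb t ht.le
      _ = C * (t ^ (α - 1) * (Real.exp (-(c * t)) * Real.exp (c / 2 * t))) := by ring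
      _ = _ := by rw [← Real.exp_add]; congr 3; ring_nf

lemma li_meas (p q : ℂ) (z : ℝ) : AEStronglyMeasurable
    (fun t : ℝ => Complex.exp (-(z * t : ℝ)) * (t : ℂ) ^ (p - 1) * ((1 + t : ℝ) : ℂ) ^ q)
    (volume.restrict (Ioi 0)) := by
  apply Measurable.aestronglyMeasurable
  fun_prop

lemma li_int {p : ℂ} (q : ℂ) {z : ℝ} (hp : 0 < p.re) (hz : 0 < z) :
    IntegrableOn (fun t : ℝ => Complex.exp (-(z * t : ℝ)) * (t : ℂ) ^ (p - 1)
      * ((1 + t : ℝ) : ℂ) ^ q) (Ioi 0) := by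
  refine Integrable.mono' (li_real_int (β := q.re) hp hz) (li_meas p q z) ?_
  refine (ae_restrict_iff' measurableSet_Ioi).2 (Eventually.of_forall fun t ht => ?_)
  rw [li_norm p q z ht]

lemma cpow_succ_aux {t : ℝ} (ht : 0 < t) (p : ℂ) :
    (t : ℂ) ^ (p + 1 - 1) = (t : ℂ) * (t : ℂ) ^ (p - 1) := by
  have h : (t : ℂ) ≠ 0 := by exact_mod_cast ht.ne'
  rw [show p + 1 - 1 = 1 + (p - 1) by ring, Complex.cpow_add _ _ h, Complex.cpow_one]

lemma li_deriv {p : ℂ} (q : ℂ) {z : ℝ} (hp : 0 < p.re) (hz : 0 < z) :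
    HasDerivAt (LI p q) (- LI (p + 1) q z) z := by
  have hp1 : 0 < (p + 1).re := by simp; linarith
  have key := hasDerivAt_integral_of_dominated_loc_of_deriv_le (𝕜 := ℝ)
    (μ := volume.restrict (Ioi (0 : ℝ)))
    (F := fun z t => Complex.exp (-(z * t : ℝ)) * (t : ℂ) ^ (p - 1) * ((1 + t : ℝ) : ℂ) ^ q)
    (F' := fun z t => - (Complex.exp (-(z * t : ℝ)) * (t : ℂ) ^ (p + 1 - 1)
      * ((1 + t : ℝ) : ℂ) ^ q))
    (x₀ := z) (s := Ioi (z / 2))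
    (bound := fun t => Real.exp (-(z / 2 * t)) * t ^ ((p + 1).re - 1) * (1 + t) ^ q.re)
    (Ioi_mem_nhds (by linarith)) (Eventually.of_forall fun x => li_meas p q x)
    (li_int q hp hz) (li_meas (p + 1) q z).neg ?_ (li_real_int hp1 (by linarith)) ?_
  · have h := key.2
    rw [integral_neg] at h
    exact h
  · refine (ae_restrict_iff' measurableSet_Ioi).2 (Eventually.of_forall fun t ht => ?_)
    intro x hx
    rw [norm_neg, li_norm (p + 1) q x ht]
    have ht : 0 < t := ht
    have hx : z / 2 < x := hx
    have hq : 0 < (1 + t) ^ q.re := Real.rpow_pos_of_pos (by linarith) _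
    gcongr
  · refine (ae_restrict_iff' measurableSet_Ioi).2 (Eventually.of_forall fun t ht => ?_)
    intro x hx
    have h1 : HasDerivAt (fun x : ℝ => Complex.exp (-(x * t : ℝ)))
        (Complex.exp (-(x * t : ℝ)) * (-(t : ℂ))) x := by
      apply HasDerivAt.cexp
      have : HasDerivAt (fun x : ℝ => x * t) t x := by
        simpa using (hasDerivAt_id x).mul_const t
      exact this.ofReal_comp.neg
    refine ((h1.mul_const ((t : ℂ) ^ (p - 1))).mul_const (((1 + t : ℝ) : ℂ) ^ q)).congr_deriv ?_
    rw [cpow_succ_aux ht]; ring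

lemma li_contig {p : ℂ} (q : ℂ) {z : ℝ} (hp : 0 < p.re) (hz : 0 < z) :
    LI p (q + 1) z = LI p q z + LI (p + 1) q z := by
  have hp1 : 0 < (p + 1).re := by simp; linarith
  unfold LI
  rw [← integral_add (li_int q hp hz) (li_int q hp1 hz)]
  refine setIntegral_congr_fun measurableSet_Ioi fun t ht => ?_
  have ht : 0 < t := ht
  have h : ((1 + t : ℝ) : ℂ) ≠ 0 := by exact_mod_cast (by linarith : 1 + t ≠ 0)
  rw [cpow_succ_aux ht, Complex.cpow_add _ _ h, Complex.cpow_one]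
  push_cast; ring

lemma li_parts {p : ℂ} (q : ℂ) {z : ℝ} (hp : 0 < p.re) (hz : 0 < z) :
    - z * LI (p + 1) (q + 1) z + p * LI p (q + 1) z + (q + 1) * LI (p + 1) q z = 0 := by
  have hp1 : 0 < (p + 1).re := by simp; linarith
  have hp0 : p ≠ 0 := by rintro rfl; simp at hp
  set f : ℝ → ℂ := fun t => Complex.exp (-(z * t : ℝ)) * (t : ℂ) ^ p * ((1 + t : ℝ) : ℂ) ^ (q + 1)
    with hf
  set f' : ℝ → ℂ := fun t =>
      - z * (Complex.exp (-(z * t : ℝ)) * (t : ℂ) ^ (p + 1 - 1) * ((1 + t : ℝ) : ℂ) ^ (q + 1))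
      + p * (Complex.exp (-(z * t : ℝ)) * (t : ℂ) ^ (p - 1) * ((1 + t : ℝ) : ℂ) ^ (q + 1))
      + (q + 1) * (Complex.exp (-(z * t : ℝ)) * (t : ℂ) ^ (p + 1 - 1) * ((1 + t : ℝ) : ℂ) ^ q)
    with hf'
  have i1 := (li_int (q + 1) hp1 hz).const_mul (-z : ℂ)
  have i2 := (li_int (q + 1) hp hz).const_mul p
  have i3 := (li_int q hp1 hz).const_mul (q + 1)
  have hintg : IntegrableOn f' (Ioi 0) := (i1.add i2).add i3
  have hval : ∫ t in Ioi (0 : ℝ), f' t =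
      - z * LI (p + 1) (q + 1) z + p * LI p (q + 1) z + (q + 1) * LI (p + 1) q z := by
    have e1 := integral_add (i1.add i2) i3
    have e2 := integral_add i1 i2
    simp only [Pi.add_apply] at e1
    rw [e2, integral_const_mul, integral_const_mul, integral_const_mul] at e1
    exact e1
  rw [← hval]
  have hder : ∀ t ∈ Ioi (0 : ℝ), HasDerivAt f (f' t) t := by
    intro t ht
    have ht : 0 < t := ht
    have h : ((1 + t : ℝ) : ℂ) ≠ 0 := by exact_mod_cast (by linarith : 1 + t ≠ 0)
    have h1 : HasDerivAt (fun t : ℝ => Complex.exp (-(z * t : ℝ)))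
        (Complex.exp (-(z * t : ℝ)) * (-(z : ℂ))) t := by
      apply HasDerivAt.cexp
      have : HasDerivAt (fun x : ℝ => z * x) z t := by
        simpa using (hasDerivAt_id t).const_mul z
      exact this.ofReal_comp.neg
    have h2 : HasDerivAt (fun t : ℝ => (t : ℂ) ^ p) (p * (t : ℂ) ^ (p - 1)) t :=
      hasDerivAt_ofReal_cpow_const ht.ne' hp0
    have h3 : HasDerivAt (fun t : ℝ => ((1 + t : ℝ) : ℂ) ^ (q + 1))
        ((q + 1) * ((1 + t : ℝ) : ℂ) ^ (q + 1 - 1) * 1) t := by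
      have hb : HasDerivAt (fun t : ℝ => ((1 + t : ℝ) : ℂ)) 1 t := by
        have : HasDerivAt (fun t : ℝ => 1 + t) 1 t := by
          simpa using (hasDerivAt_id t).const_add 1
        simpa using this.ofReal_comp
      have hc : HasDerivAt (fun w : ℂ => w ^ (q + 1)) ((q + 1) * ((1 + t : ℝ) : ℂ) ^ (q + 1 - 1))
          ((1 + t : ℝ) : ℂ) := by
        have := (hasDerivAt_id ((1 + t : ℝ) : ℂ)).cpow_const (c := q + 1) (Or.inl (by
          simp only [id, Complex.ofReal_re]; linarith))
        simpa using this
      exact HasDerivAt.comp (𝕜 := ℝ) (𝕜' := ℂ) t hc hb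
    refine ((h1.mul h2).mul h3).congr_deriv ?_
    simp only [hf', Pi.mul_apply, add_sub_cancel_right]
    ring
  have hcont : ContinuousWithinAt f (Ici 0) 0 := by
    apply ContinuousAt.continuousWithinAt
    refine ContinuousAt.mul (ContinuousAt.mul ?_ ?_) ?_
    · fun_prop
    · exact (Complex.continuousAt_ofReal_cpow_const 0 p (Or.inl hp))
    · refine ContinuousAt.cpow ?_ continuousAt_const ?_
      · fun_prop
      · left; simp
  have htop : Tendsto f atTop (𝓝 0) := by
    exact tendsto_zero_of_hasDerivAt_of_integrableOn_Ioi hder hintg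
      (by
        have := li_int (q + 1) hp1 hz
        simpa only [add_sub_cancel_right] using this)
  rw [integral_Ioi_of_hasDerivAt_of_tendsto hcont hder hintg htop]
  simp [hf, hp0]

/-- Kummer ODE for the Laplace integral -/
lemma li_ode {A : ℂ} (b : ℂ) {z : ℝ} (hA : 0 < A.re) (hz : 0 < z) :
    (z : ℂ) * LI (A + 1 + 1) (b - A - 1) z + (b - z) * (- LI (A + 1) (b - A - 1) z)
      - A * LI A (b - A - 1) z = 0 := by
  have hA1 : 0 < (A + 1).re := by simp; linarith
  have h1 := li_parts (b - A - 1) hA hz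
  rw [li_contig _ hA hz, li_contig _ hA1 hz] at h1
  linear_combination -h1

lemma beta_sub (A : ℂ) {b : ℝ} (hA : 0 < A.re) (hb : b < 1) :
    IntegrableOn (fun t : ℝ => (t : ℂ) ^ (A - 1) * ((1 + t : ℝ) : ℂ) ^ ((b : ℂ) - A - 1)) (Ioi 0) ∧
    ∫ t in Ioi (0 : ℝ), (t : ℂ) ^ (A - 1) * ((1 + t : ℝ) : ℂ) ^ ((b : ℂ) - A - 1)
      = Complex.Gamma A * Complex.Gamma (1 - b) / Complex.Gamma (1 + A - b) := by
  set f : ℝ → ℝ := fun x => x / (1 - x) with hf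
  set f' : ℝ → ℝ := fun x => 1 / (1 - x) ^ 2 with hf'
  have himg : f '' Ioo 0 1 = Ioi 0 := by
    ext t
    constructor
    · rintro ⟨x, ⟨h0, h1⟩, rfl⟩
      exact div_pos h0 (by linarith)
    · intro ht
      have ht : 0 < t := ht
      refine ⟨t / (1 + t), ⟨by positivity, by rw [div_lt_one (by linarith)]; linarith⟩, ?_⟩
      simp only [hf]
      have : 1 + t ≠ 0 := by linarith
      have h2 : 1 - t / (1 + t) = 1 / (1 + t) := by field_simp; ring
      rw [h2]; field_simp
  have hder : ∀ x ∈ Ioo (0 : ℝ) 1, HasDerivWithinAt f (f' x) (Ioo 0 1) x := by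
    intro x hx
    have h1 : (1 - x) ≠ 0 := by have := hx.2; linarith
    have := (hasDerivAt_id x).div ((hasDerivAt_id x).const_sub 1) h1
    refine (this.congr_deriv ?_).hasDerivWithinAt
    simp only [hf', id]
    field_simp
    ring
  have hinj : InjOn f (Ioo 0 1) := by
    intro x hx y hy hxy
    have h1 : (1 - x) ≠ 0 := by have := hx.2; linarith
    have h2 : (1 - y) ≠ 0 := by have := hy.2; linarith
    simp only [hf] at hxy
    rw [div_eq_div_iff h1 h2] at hxy
    linarith
  set g : ℝ → ℂ := fun t => (t : ℂ) ^ (A - 1) * ((1 + t : ℝ) : ℂ) ^ ((b : ℂ) - A - 1) with hg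
  have heq : ∀ x ∈ Ioo (0 : ℝ) 1, |f' x| • g (f x) =
      (x : ℂ) ^ (A - 1) * (1 - (x : ℂ)) ^ ((1 - b : ℂ) - 1) := by
    intro x hx
    have hx0 : 0 < x := hx.1
    have h1 : 0 < 1 - x := by have := hx.2; linarith
    have e1 : 1 + f x = (1 - x)⁻¹ := by simp only [hf]; field_simp; ring
    have e2 : |f' x| = ((1 - x) ^ 2)⁻¹ := by
      simp only [hf']; rw [abs_of_pos (by positivity)]; simp
    have hne : ((1 - x : ℝ) : ℂ) ≠ 0 := by exact_mod_cast h1.ne'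
    simp only [hg]
    rw [e1, e2]
    simp only [hf, div_eq_mul_inv]
    rw [Complex.ofReal_mul, Complex.mul_cpow_ofReal_nonneg hx0.le (inv_pos.2 h1).le]
    have e3 : ∀ r : ℂ, (((1 - x)⁻¹ : ℝ) : ℂ) ^ r = ((1 - x : ℝ) : ℂ) ^ (-r) := by
      intro r
      rw [Complex.ofReal_inv, Complex.inv_cpow, Complex.cpow_neg]
      rw [Complex.arg_ofReal_of_nonneg h1.le]; exact Real.pi_pos.ne
    rw [e3, e3, Complex.real_smul]
    have e4 : ((((1 - x) ^ 2)⁻¹ : ℝ) : ℂ) = ((1 - x : ℝ) : ℂ) ^ (-2 : ℂ) := by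
      rw [Complex.cpow_neg]; push_cast
      congr 1
      rw [← Complex.cpow_natCast]; norm_num
    rw [e4, show (1 - (x : ℂ)) = ((1 - x : ℝ) : ℂ) by push_cast; ring]
    have e5 : ((1 - x : ℝ) : ℂ) ^ ((1 - b : ℂ) - 1) = ((1 - x : ℝ) : ℂ) ^ (-2 : ℂ) *
       (((1 - x : ℝ) : ℂ) ^ (-(A - 1)) * ((1 - x : ℝ) : ℂ) ^ (-((b : ℂ) - A - 1))) := by
      rw [← Complex.cpow_add _ _ hne, ← Complex.cpow_add _ _ hne]
      congr 1; ring
    rw [e5]; ring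
  have hv : 0 < (1 - b : ℂ).re := by simp; linarith
  have hconv := Complex.betaIntegral_convergent hA hv
  rw [intervalIntegrable_iff_integrableOn_Ioo_of_le zero_le_one] at hconv
  have hbeta : Complex.betaIntegral A (1 - b) = ∫ x in Ioo (0 : ℝ) 1,
      (x : ℂ) ^ (A - 1) * (1 - (x : ℂ)) ^ ((1 - b : ℂ) - 1) := by
    unfold Complex.betaIntegral
    rw [intervalIntegral.integral_of_le zero_le_one, integral_Ioc_eq_integral_Ioo]
  constructor
  · rw [← himg, integrableOn_image_iff_integrableOn_abs_deriv_smul measurableSet_Ioo hder hinj]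
    exact hconv.congr_fun (fun x hx => (heq x hx).symm) measurableSet_Ioo
  · rw [← himg, integral_image_eq_integral_abs_deriv_smul measurableSet_Ioo hder hinj,
      setIntegral_congr_fun measurableSet_Ioo heq, ← hbeta]
    have h := Complex.Gamma_mul_Gamma_eq_betaIntegral hA hv
    have hne : Complex.Gamma (1 + A - b) ≠ 0 := by
      apply Complex.Gamma_ne_zero_of_re_pos
      simp; linarith
    rw [h, show A + (1 - b : ℂ) = 1 + A - b by ring]
    field_simp

lemma li_tendsto_zero (A : ℂ) {b : ℝ} (hA : 0 < A.re) (hb : b < 1) :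
    Tendsto (LI A ((b : ℂ) - A - 1)) (𝓝[>] 0)
      (𝓝 (Complex.Gamma A * Complex.Gamma (1 - b) / Complex.Gamma (1 + A - b))) := by
  obtain ⟨h1, h2⟩ := beta_sub A hA hb
  rw [← h2]
  unfold LI
  refine tendsto_integral_filter_of_dominated_convergence
    (fun t => ‖(t : ℂ) ^ (A - 1) * ((1 + t : ℝ) : ℂ) ^ ((b : ℂ) - A - 1)‖)
    (Eventually.of_forall fun z => li_meas _ _ z) ?_ h1.norm ?_
  · filter_upwards [self_mem_nhdsWithin] with z hz
    have hz : 0 < z := hz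
    refine (ae_restrict_iff' measurableSet_Ioi).2 (Eventually.of_forall fun t ht => ?_)
    have ht : 0 < t := ht
    rw [mul_assoc, norm_mul]
    refine mul_le_of_le_one_left (norm_nonneg _) ?_
    rw [Complex.norm_exp]
    simp
    positivity
  · refine Eventually.of_forall fun t => ?_
    have : Tendsto (fun z : ℝ => Complex.exp (-(z * t : ℝ)) * (t : ℂ) ^ (A - 1)
        * ((1 + t : ℝ) : ℂ) ^ ((b : ℂ) - A - 1)) (𝓝 0) (𝓝 (Complex.exp (-((0 : ℝ) * t : ℝ))
        * (t : ℂ) ^ (A - 1) * ((1 + t : ℝ) : ℂ) ^ ((b : ℂ) - A - 1))) := by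
      apply Continuous.tendsto (f := fun z : ℝ => Complex.exp (-(z * t : ℝ)) * (t : ℂ) ^ (A - 1)
        * ((1 + t : ℝ) : ℂ) ^ ((b : ℂ) - A - 1))
      fun_prop
    simp only [zero_mul, Complex.ofReal_zero, neg_zero, Complex.exp_zero, one_mul] at this
    exact this.mono_left nhdsWithin_le_nhds

lemma li_deriv_tendsto (A : ℂ) {b : ℝ} (hA : 0 < A.re) (hb0 : 0 < b) (hb : b < 1) :
    Tendsto (fun z : ℝ => ((z ^ b : ℝ) : ℂ) * LI (A + 1) ((b : ℂ) - A - 1) z) (𝓝[>] 0)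
      (𝓝 (Complex.Gamma b)) := by
  have hGb : 0 < (b : ℂ).re := by simpa using hb0
  have hconv := Complex.GammaIntegral_convergent hGb
  rw [Complex.Gamma_eq_integral hGb]
  unfold Complex.GammaIntegral
  have key : Tendsto (fun z : ℝ => ∫ s in Ioi (0 : ℝ), ((-s).exp : ℂ) * (s : ℂ) ^ A
      * ((z + s : ℝ) : ℂ) ^ ((b : ℂ) - A - 1)) (𝓝[>] 0)
      (𝓝 (∫ s in Ioi (0 : ℝ), ((-s).exp : ℂ) * (s : ℂ) ^ ((b : ℂ) - 1))) := by
    refine tendsto_integral_filter_of_dominated_convergence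
      (fun s => ‖((-s).exp : ℂ) * (s : ℂ) ^ ((b : ℂ) - 1)‖) ?_ ?_ hconv.norm ?_
    · refine Eventually.of_forall fun z => Measurable.aestronglyMeasurable ?_
      fun_prop
    · filter_upwards [self_mem_nhdsWithin] with z hz
      have hz : 0 < z := hz
      refine (ae_restrict_iff' measurableSet_Ioi).2 (Eventually.of_forall fun t ht => ?_)
      have ht : 0 < t := ht
      rw [mul_assoc, norm_mul, norm_mul, norm_mul]
      refine mul_le_mul_of_nonneg_left ?_ (norm_nonneg _)
      rw [Complex.norm_cpow_eq_rpow_re_of_pos ht, Complex.norm_cpow_eq_rpow_re_of_pos ht,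
        Complex.norm_cpow_eq_rpow_re_of_pos (by linarith)]
      have h1 : (z + t) ^ ((b : ℂ) - A - 1).re ≤ t ^ ((b : ℂ) - A - 1).re := by
        apply Real.rpow_le_rpow_of_nonpos ht (by linarith)
        simp; linarith
      calc _ ≤ t ^ A.re * t ^ ((b : ℂ) - A - 1).re := by gcongr
        _ = _ := by rw [← Real.rpow_add ht]; congr 1; simp; ring
    · refine (ae_restrict_iff' measurableSet_Ioi).2 (Eventually.of_forall fun t ht => ?_)
      have ht : 0 < t := ht
      have htc : (t : ℂ) ≠ 0 := by exact_mod_cast ht.ne'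
      have e : (t : ℂ) ^ ((b : ℂ) - 1) = (t : ℂ) ^ A * ((0 + t : ℝ) : ℂ) ^ ((b : ℂ) - A - 1) := by
        rw [zero_add, ← Complex.cpow_add _ _ htc]; congr 1; ring
      rw [e, ← mul_assoc]
      refine Tendsto.mono_left ?_ nhdsWithin_le_nhds
      refine tendsto_const_nhds.mul ?_
      have : ContinuousAt (fun z : ℝ => ((z + t : ℝ) : ℂ) ^ ((b : ℂ) - A - 1)) 0 := by
        refine ContinuousAt.cpow ?_ continuousAt_const ?_
        · fun_prop
        · left; simpa using ht
      exact this.tendsto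
  refine key.congr' ?_
  filter_upwards [self_mem_nhdsWithin] with z hz
  have hz : 0 < z := hz
  have hzc : (z : ℂ) ≠ 0 := by exact_mod_cast hz.ne'
  have hsub := integral_comp_mul_left_Ioi (fun s : ℝ => ((-s).exp : ℂ) * (s : ℂ) ^ A
      * ((z + s : ℝ) : ℂ) ^ ((b : ℂ) - A - 1)) 0 hz
  rw [mul_zero] at hsub
  have h2 : (∫ s in Ioi (0 : ℝ), ((-s).exp : ℂ) * (s : ℂ) ^ A
      * ((z + s : ℝ) : ℂ) ^ ((b : ℂ) - A - 1)) = z * ∫ s in Ioi (0 : ℝ), ((-(z * s)).exp : ℂ) *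
      ((z * s : ℝ) : ℂ) ^ A * ((z + z * s : ℝ) : ℂ) ^ ((b : ℂ) - A - 1) := by
    rw [hsub, Complex.real_smul]; push_cast; field_simp
  rw [h2]
  unfold LI
  rw [← integral_const_mul, ← integral_const_mul]
  refine setIntegral_congr_fun measurableSet_Ioi fun t ht => ?_
  have ht : 0 < t := ht
  have e1 : ((z * t : ℝ) : ℂ) ^ A = (z : ℂ) ^ A * (t : ℂ) ^ A := by
    rw [Complex.ofReal_mul, Complex.mul_cpow_ofReal_nonneg hz.le ht.le]
  have e2 : ((z + z * t : ℝ) : ℂ) ^ ((b : ℂ) - A - 1) =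
      (z : ℂ) ^ ((b : ℂ) - A - 1) * ((1 + t : ℝ) : ℂ) ^ ((b : ℂ) - A - 1) := by
    rw [← Complex.mul_cpow_ofReal_nonneg hz.le (by linarith : 0 ≤ 1 + t), ← Complex.ofReal_mul]
    congr 2; ring
  have e3 : ((z ^ b : ℝ) : ℂ) = z * ((z : ℂ) ^ A * (z : ℂ) ^ ((b : ℂ) - A - 1)) := by
    rw [← Complex.cpow_add _ _ hzc, Complex.ofReal_cpow hz.le]
    have : (b : ℂ) = 1 + (A + ((b : ℂ) - A - 1)) := by ring
    conv_lhs => rw [this]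
    rw [Complex.cpow_add _ _ hzc, Complex.cpow_one]
  rw [e1, e2, e3, add_sub_cancel_right]
  push_cast
  ring

/-- solution data for the Kummer equation on `(0,∞)` -/
def IsSol (A : ℂ) (b : ℝ) (y y' : ℝ → ℂ) (α β : ℂ) : Prop :=
  ∃ y'' : ℝ → ℂ, (∀ z : ℝ, 0 < z → HasDerivAt y (y' z) z ∧ HasDerivAt y' (y'' z) z ∧
    (z : ℂ) * y'' z + ((b : ℂ) - z) * y' z - A * y z = 0) ∧
    Tendsto y (𝓝[>] 0) (𝓝 α) ∧ Tendsto (fun z : ℝ => ((z ^ b : ℝ) : ℂ) * y' z) (𝓝[>] 0) (𝓝 β)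

lemma wron {A : ℂ} {b : ℝ} {y₁ y₁' y₂ y₂' : ℝ → ℂ} {α₁ β₁ α₂ β₂ : ℂ}
    (h1 : IsSol A b y₁ y₁' α₁ β₁) (h2 : IsSol A b y₂ y₂' α₂ β₂) {z : ℝ} (hz : 0 < z) :
    ((z ^ b * Real.exp (-z) : ℝ) : ℂ) * (y₁ z * y₂' z - y₁' z * y₂ z) = α₁ * β₂ - β₁ * α₂ := by
  obtain ⟨y₁'', d1, l1, m1⟩ := h1
  obtain ⟨y₂'', d2, l2, m2⟩ := h2
  set W : ℝ → ℂ := fun z => ((z ^ b * Real.exp (-z) : ℝ) : ℂ) * (y₁ z * y₂' z - y₁' z * y₂ z)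
    with hW
  have hder : ∀ z ∈ Ioi (0 : ℝ), HasDerivAt W 0 z := by
    intro z hz
    have hz : 0 < z := hz
    obtain ⟨a1, a2, a3⟩ := d1 z hz
    obtain ⟨b1, b2, b3⟩ := d2 z hz
    have hw : HasDerivAt (fun z : ℝ => z ^ b * Real.exp (-z))
        ((b * z ^ (b - 1)) * Real.exp (-z) + z ^ b * (Real.exp (-z) * (-1))) z :=
      (Real.hasDerivAt_rpow_const (Or.inl hz.ne')).mul ((hasDerivAt_neg z).exp)
    have := hw.ofReal_comp.mul ((a1.mul b2).sub (a2.mul b1))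
    refine this.congr_deriv ?_
    have hzc : (z : ℂ) ≠ 0 := by exact_mod_cast hz.ne'
    have e : z ^ (b - 1) = z ^ b / z := by rw [Real.rpow_sub hz, Real.rpow_one]
    simp only [Pi.mul_apply, Pi.sub_apply]
    rw [e]
    push_cast
    field_simp
    linear_combination ((z ^ b : ℝ) : ℂ) * Complex.exp (-z) * (y₁ z * b3 - y₂ z * a3)
  have hconst : ∀ x ∈ Ioi (0 : ℝ), W x = W z := by
    intro x hx
    refine isOpen_Ioi.is_const_of_deriv_eq_zero (convex_Ioi 0).isPreconnected
      (fun x hx => (hder x hx).differentiableAt.differentiableWithinAt)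
      (fun x hx => (hder x hx).deriv) hx hz
  have hlim : Tendsto W (𝓝[>] 0) (𝓝 (α₁ * β₂ - β₁ * α₂)) := by
    have he : Tendsto (fun z : ℝ => ((Real.exp (-z) : ℝ) : ℂ)) (𝓝[>] 0) (𝓝 1) := by
      have : Continuous (fun z : ℝ => ((Real.exp (-z) : ℝ) : ℂ)) := by fun_prop
      have h := this.tendsto 0
      simp only [neg_zero, Real.exp_zero, Complex.ofReal_one] at h
      exact h.mono_left nhdsWithin_le_nhds
    have := he.mul ((l1.mul m2).sub (m1.mul l2))
    rw [one_mul] at this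
    refine this.congr fun z => ?_
    simp only [hW]; push_cast; ring
  have hlim2 : Tendsto W (𝓝[>] 0) (𝓝 (W z)) := by
    refine tendsto_const_nhds.congr' ?_
    filter_upwards [self_mem_nhdsWithin] with x hx
    exact (hconst x hx).symm
  exact tendsto_nhds_unique hlim2 hlim

lemma sol_combine {A : ℂ} {b : ℝ} {y₁ y₁' y₂ y₂' y₃ y₃' : ℝ → ℂ} {α₁ β₁ α₂ β₂ α₃ β₃ : ℂ}
    (h1 : IsSol A b y₁ y₁' α₁ β₁) (h2 : IsSol A b y₂ y₂' α₂ β₂) (h3 : IsSol A b y₃ y₃' α₃ β₃)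
    {z : ℝ} (hz : 0 < z) :
    y₃ z * (α₁ * β₂ - β₁ * α₂) + y₁ z * (α₂ * β₃ - β₂ * α₃) + y₂ z * (α₃ * β₁ - β₃ * α₁) = 0 := by
  rw [← wron h1 h2 hz, ← wron h2 h3 hz, ← wron h3 h1 hz]
  ring

lemma ps_real_deriv {c : ℕ → ℂ} (h : CoefBd c) (z : ℝ) :
    HasDerivAt (fun z : ℝ => ps c z) (ps (shiftC c) z) z :=
  (ps_hasDerivAt h z).comp_ofReal

lemma ps_real_tendsto {c : ℕ → ℂ} (h : CoefBd c) :
    Tendsto (fun z : ℝ => ps c z) (𝓝[>] 0) (𝓝 (c 0)) := by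
  have := (ps_real_deriv h 0).continuousAt.tendsto
  simp only [Complex.ofReal_zero, ps_zero] at this
  exact this.mono_left nhdsWithin_le_nhds

lemma sol_one (A : ℂ) {b : ℝ} (hb0 : 0 < b) (hb : ∀ n : ℕ, (b : ℂ) + n ≠ 0) :
    IsSol A b (fun z : ℝ => ps (kc A b) z) (fun z : ℝ => ps (shiftC (kc A b)) z) 1 0 := by
  have hc := kc_bd A hb
  refine ⟨fun z => ps (shiftC (shiftC (kc A b))) z, fun z hz => ⟨ps_real_deriv hc z,
    ps_real_deriv hc.shift z, kummer_ode A hb z⟩, ?_, ?_⟩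
  · have := ps_real_tendsto hc
    rwa [kc_zero] at this
  · have h1 := ps_real_tendsto hc.shift
    have h2 : Tendsto (fun z : ℝ => ((z ^ b : ℝ) : ℂ)) (𝓝[>] 0) (𝓝 0) := by
      have : ContinuousAt (fun z : ℝ => z ^ b) 0 :=
        Real.continuousAt_rpow_const 0 b (Or.inr hb0.le)
      have h := (Complex.continuous_ofReal.continuousAt.comp this).tendsto
      simp only [Function.comp_def, Real.zero_rpow hb0.ne', Complex.ofReal_zero] at h
      exact h.mono_left nhdsWithin_le_nhds
    simpa using h2.mul h1

lemma rpow_ofReal_deriv {z : ℝ} (hz : 0 < z) (r : ℝ) :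
    HasDerivAt (fun z : ℝ => ((z ^ r : ℝ) : ℂ)) ((r : ℂ) * ((z ^ (r - 1) : ℝ) : ℂ)) z := by
  have := (Real.hasDerivAt_rpow_const (p := r) (Or.inl hz.ne')).ofReal_comp
  refine this.congr_deriv ?_
  push_cast; ring

lemma sol_two (A : ℂ) {b : ℝ} (hb1 : b < 1) (hb : ∀ n : ℕ, 2 - (b : ℂ) + n ≠ 0) :
    IsSol A b (fun z : ℝ => ((z ^ (1 - b) : ℝ) : ℂ) * ps (kc (1 + A - b) (2 - b)) z)
      (fun z : ℝ => (1 - b : ℂ) * ((z ^ (-b) : ℝ) : ℂ) * ps (kc (1 + A - b) (2 - b)) z +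
        ((z ^ (1 - b) : ℝ) : ℂ) * ps (shiftC (kc (1 + A - b) (2 - b))) z) 0 (1 - b) := by
  have hc := kc_bd (1 + A - b) hb
  set c := kc (1 + A - b) (2 - b) with hcdef
  refine ⟨fun z : ℝ => (1 - b : ℂ) * ((-b : ℂ) * ((z ^ (-b - 1) : ℝ) : ℂ)) * ps c z
    + 2 * (1 - b : ℂ) * ((z ^ (-b) : ℝ) : ℂ) * ps (shiftC c) z
    + ((z ^ (1 - b) : ℝ) : ℂ) * ps (shiftC (shiftC c)) z, fun z hz => ⟨?_, ?_, ?_⟩, ?_, ?_⟩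
  · refine ((rpow_ofReal_deriv hz (1 - b)).mul (ps_real_deriv hc z)).congr_deriv ?_
    rw [show 1 - b - 1 = -b by ring]; push_cast; ring
  · refine ((((rpow_ofReal_deriv hz (-b)).const_mul (1 - b : ℂ)).mul (ps_real_deriv hc z)).add
      ((rpow_ofReal_deriv hz (1 - b)).mul (ps_real_deriv hc.shift z))).congr_deriv ?_
    rw [show 1 - b - 1 = -b by ring]; push_cast; ring
  · have ho := kummer_ode (1 + A - b) hb z
    rw [← hcdef] at ho
    have hzc : (z : ℂ) ≠ 0 := by exact_mod_cast hz.ne'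
    have e1 : z ^ (-b - 1) = z ^ (-b) / z := by rw [Real.rpow_sub hz, Real.rpow_one]
    have e2 : z ^ (1 - b) = z ^ (-b) * z := by
      rw [show 1 - b = -b + 1 by ring, Real.rpow_add hz, Real.rpow_one]
    beta_reduce
    rw [e1, e2]
    push_cast
    field_simp
    linear_combination (z : ℂ) * ((z ^ (-b) : ℝ) : ℂ) * ho
  · have h1 := ps_real_tendsto hc
    have h2 : Tendsto (fun z : ℝ => ((z ^ (1 - b) : ℝ) : ℂ)) (𝓝[>] 0) (𝓝 0) := by
      have : ContinuousAt (fun z : ℝ => z ^ (1 - b)) 0 :=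
        Real.continuousAt_rpow_const 0 (1 - b) (Or.inr (by linarith))
      have h := (Complex.continuous_ofReal.continuousAt.comp this).tendsto
      simp only [Function.comp_def, Real.zero_rpow (by linarith : 1 - b ≠ 0),
        Complex.ofReal_zero] at h
      exact h.mono_left nhdsWithin_le_nhds
    simpa using h2.mul h1
  · have h1 := ps_real_tendsto hc
    rw [hcdef, kc_zero, ← hcdef] at h1
    have h2 := ps_real_tendsto hc.shift
    have h3 : Tendsto (fun z : ℝ => (z : ℂ)) (𝓝[>] 0) (𝓝 0) := by
      have := Complex.continuous_ofReal.tendsto 0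
      rw [Complex.ofReal_zero] at this
      exact this.mono_left nhdsWithin_le_nhds
    have h4 := (h1.const_mul (1 - b : ℂ)).add (h3.mul h2)
    simp only [mul_one, zero_mul, add_zero] at h4
    refine h4.congr' ?_
    filter_upwards [self_mem_nhdsWithin] with z hz
    have hz : 0 < z := hz
    have e1 : ((z ^ b : ℝ) : ℂ) * ((z ^ (-b) : ℝ) : ℂ) = 1 := by
      rw [← Complex.ofReal_mul, ← Real.rpow_add hz]; simp
    have e2 : ((z ^ b : ℝ) : ℂ) * ((z ^ (1 - b) : ℝ) : ℂ) = z := by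
      rw [← Complex.ofReal_mul, ← Real.rpow_add hz]; simp
    linear_combination (-(1 - b : ℂ) * ps c z) * e1 - ps (shiftC c) z * e2

lemma sol_three (A : ℂ) {b : ℝ} (hA : 0 < A.re) (hb0 : 0 < b) (hb1 : b < 1) :
    IsSol A b (LI A ((b : ℂ) - A - 1)) (fun z => - LI (A + 1) ((b : ℂ) - A - 1) z)
      (Complex.Gamma A * Complex.Gamma (1 - b) / Complex.Gamma (1 + A - b))
      (- Complex.Gamma b) := by
  have hA1 : 0 < (A + 1).re := by simp; linarith
  refine ⟨fun z => LI (A + 1 + 1) ((b : ℂ) - A - 1) z, fun z hz => ⟨li_deriv _ hA hz, ?_,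
    li_ode b hA hz⟩, li_tendsto_zero A hA hb1, ?_⟩
  · have h := (li_deriv ((b : ℂ) - A - 1) hA1 hz).neg
    rw [neg_neg] at h
    exact h
  · simpa using (li_deriv_tendsto A hA hb0 hb1).neg

lemma base_case (A : ℂ) {b : ℝ} (hA : 0 < A.re) (hb0 : 0 < b) (hb1 : b < 1) {z : ℝ} (hz : 0 < z) :
    LI A ((b : ℂ) - A - 1) z = Complex.Gamma A * tricomiU A b z := by
  have hG : Complex.Gamma A ≠ 0 := Complex.Gamma_ne_zero_of_re_pos hA
  have n1 : ∀ n : ℕ, (b : ℂ) + n ≠ 0 := by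
    intro n
    have : (b : ℝ) + n ≠ 0 := by positivity
    exact_mod_cast this
  have n2 : ∀ n : ℕ, 2 - (b : ℂ) + n ≠ 0 := by
    intro n
    have h0 : (0 : ℝ) ≤ n := by positivity
    have : (2 - b : ℝ) + n ≠ 0 := by linarith
    exact_mod_cast this
  have hb1c : (1 - b : ℂ) ≠ 0 := by
    have : (1 - b : ℝ) ≠ 0 := by linarith
    exact_mod_cast this
  have key := sol_combine (sol_one A hb0 n1) (sol_two A hb1 n2) (sol_three A hA hb0 hb1) hz
  have hg : Complex.Gamma b = (b - 1 : ℂ) * Complex.Gamma (b - 1) := by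
    have := Complex.Gamma_add_one (b - 1 : ℂ) (by
      intro h; apply hb1c; linear_combination -h)
    rwa [sub_add_cancel] at this
  unfold tricomiU
  rw [hyp_eq_ps, hyp_eq_ps]
  have e : (z : ℂ) ^ (1 - b : ℂ) = ((z ^ (1 - b) : ℝ) : ℂ) := by
    rw [Complex.ofReal_cpow hz.le]; push_cast; rfl
  rw [e]
  rw [hg] at key
  apply mul_right_cancel₀ hb1c
  have e3 : Complex.Gamma A * (Complex.Gamma (b - 1) / Complex.Gamma A) = Complex.Gamma (b - 1) :=
    mul_div_cancel₀ _ hG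
  linear_combination key - ((z ^ (1 - b) : ℝ) : ℂ) * ps (kc (1 + A - b) (2 - b)) z * (1 - b) * e3

lemma rec_step (A : ℂ) (hA : A.im ≠ 0) (hAre : 0 < A.re) {b : ℝ} (hb : ∀ m : ℤ, b ≠ m)
    (ih : ∀ z : ℝ, 0 < z → LI A ((b : ℂ) - A - 1) z = Complex.Gamma A * tricomiU A b z)
    {z : ℝ} (hz : 0 < z) :
    LI A ((b + 1 : ℝ) - A - 1) z = Complex.Gamma A * tricomiU A ((b + 1 : ℝ) : ℂ) z := by
  have hG : Complex.Gamma A ≠ 0 := Complex.Gamma_ne_zero_of_re_pos hAre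
  have n1 : ∀ n : ℕ, (b : ℂ) + n ≠ 0 := by
    intro n h
    have h : (b : ℝ) + n = 0 := by exact_mod_cast h
    apply hb (-n); push_cast; linarith
  have n2 : ∀ n : ℕ, 1 - (b : ℂ) + n ≠ 0 := by
    intro n h
    have h : 1 - (b : ℝ) + n = 0 := by exact_mod_cast h
    apply hb (1 + n); push_cast; linarith
  have n2' : ∀ n : ℕ, 2 - (b : ℂ) + n ≠ 0 := by
    intro n h
    apply n2 (n + 1); push_cast; linear_combination h
  have hzc : (z : ℂ) ≠ 0 := by exact_mod_cast hz.ne'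
  have h1b : (1 - b : ℂ) ≠ 0 := by simpa using n2 0
  have hb0 : (b : ℂ) ≠ 0 := by simpa using n1 0
  have hAb : A - b ≠ 0 := by
    intro h; apply hA
    have := congrArg Complex.im h
    simpa using this
  have c1 := kummer_contig1 A n1 z
  have c2 := kummer_contig2 (A - b) n2 z
  rw [show A - b + 1 = 1 + A - b by ring, show (1 - b : ℂ) + 1 = 2 - b by ring] at c2
  -- derivative of U
  have dM := ps_real_deriv (kc_bd A n1) z
  have dN := ps_real_deriv (kc_bd (1 + A - b) n2') z
  have dU : HasDerivAt (fun z : ℝ => tricomiU A b z)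
      (Complex.Gamma (1 - b) / Complex.Gamma (1 + A - b) * ps (shiftC (kc A b)) z +
       Complex.Gamma (b - 1) / Complex.Gamma A *
        (((1 - b : ℝ) : ℂ) * ((z ^ (1 - b - 1) : ℝ) : ℂ) * ps (kc (1 + A - b) (2 - b)) z
        + ((z ^ (1 - b) : ℝ) : ℂ) * ps (shiftC (kc (1 + A - b) (2 - b))) z)) z := by
    have := (dM.const_mul (Complex.Gamma (1 - b) / Complex.Gamma (1 + A - b))).add
      (((rpow_ofReal_deriv hz (1 - b)).mul dN).const_mul (Complex.Gamma (b - 1) / Complex.Gamma A))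
    refine this.congr_of_eventuallyEq ?_
    filter_upwards [Ioi_mem_nhds hz] with x hx
    have hx : 0 < x := hx
    have e : (x : ℂ) ^ (1 - b : ℂ) = ((x ^ (1 - b) : ℝ) : ℂ) := by
      rw [Complex.ofReal_cpow hx.le]; push_cast; rfl
    unfold tricomiU
    rw [hyp_eq_ps, hyp_eq_ps, e]
    simp only [Pi.add_apply, Pi.mul_apply]
    ring
  have dL := li_deriv ((b : ℂ) - A - 1) hAre hz
  have dL' : HasDerivAt (LI A ((b : ℂ) - A - 1)) _ z :=
    (dU.const_mul (Complex.Gamma A)).congr_of_eventuallyEq (by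
      filter_upwards [Ioi_mem_nhds hz] with x hx
      exact ih x hx)
  have hd := dL.unique dL'
  have hcon := li_contig ((b : ℂ) - A - 1) hAre hz
  have e0 : (((b + 1 : ℝ) : ℂ) - A - 1) = ((b : ℂ) - A - 1) + 1 := by push_cast; ring
  rw [e0, hcon, ih z hz, neg_eq_iff_eq_neg.1 hd]
  have e : (z : ℂ) ^ (1 - b : ℂ) = ((z ^ (1 - b) : ℝ) : ℂ) := by
    rw [Complex.ofReal_cpow hz.le]; push_cast; rfl
  have e' : (z : ℂ) ^ (1 - ((b + 1 : ℝ) : ℂ)) = ((z ^ (-b) : ℝ) : ℂ) := by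
    rw [Complex.ofReal_cpow hz.le]; push_cast; congr 1; ring
  have e2 : z ^ (1 - b) = z ^ (-b) * z := by
    rw [show 1 - b = -b + 1 by ring, Real.rpow_add hz, Real.rpow_one]
  unfold tricomiU
  simp only [hyp_eq_ps]
  rw [e, e', e2, show 1 - b - 1 = -b by ring]
  push_cast
  rw [show (1 : ℂ) - (b + 1) = -b by ring, show (1 : ℂ) + A - (b + 1) = A - b by ring,
    show (2 : ℂ) - (b + 1) = 1 - b by ring, show (b : ℂ) + 1 - 1 = b by ring]
  have g1 : Complex.Gamma (1 - b : ℂ) = (-b) * Complex.Gamma (-b : ℂ) := by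
    rw [← Complex.Gamma_add_one _ (neg_ne_zero.2 hb0)]; congr 1; ring
  have g2 : Complex.Gamma (1 + A - b : ℂ) = (A - b) * Complex.Gamma (A - b : ℂ) := by
    rw [← Complex.Gamma_add_one _ hAb]; congr 1; ring
  have g3 : Complex.Gamma (b : ℂ) = (b - 1) * Complex.Gamma (b - 1 : ℂ) := by
    rw [← Complex.Gamma_add_one _ (by intro h; apply h1b; linear_combination -h)]; congr 1; ring
  have hGAb : Complex.Gamma (A - b) ≠ 0 := by
    apply Complex.Gamma_ne_zero
    intro m h
    apply hA
    have := congrArg Complex.im h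
    simpa using this
  rw [g1, g2, g3]
  have k1 : (-b * Complex.Gamma (-b : ℂ)) / ((A - b) * Complex.Gamma (A - b)) *
      (ps (kc A b) z - ps (shiftC (kc A b)) z) =
      Complex.Gamma (-b : ℂ) / Complex.Gamma (A - b) * ps (kc A (b + 1)) z := by
    field_simp
    linear_combination (-Complex.Gamma (-b : ℂ)) * c1
  linear_combination Complex.Gamma A * k1
    + Complex.Gamma A * (Complex.Gamma (b - 1) / Complex.Gamma A) * ((z ^ (-b) : ℝ) : ℂ) * c2

lemma gamma_mul_tricomi (A : ℂ) (hA : A.im ≠ 0) (hAre : 0 < A.re) {b : ℝ} (hb0 : 0 < b)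
    (hb : ∀ m : ℤ, b ≠ m) {z : ℝ} (hz : 0 < z) :
    LI A ((b : ℂ) - A - 1) z = Complex.Gamma A * tricomiU A b z := by
  have main : ∀ n : ℕ, ∀ β : ℝ, 0 < β → β < 1 → ∀ z : ℝ, 0 < z →
      LI A (((β + n : ℝ) : ℂ) - A - 1) z = Complex.Gamma A * tricomiU A ((β + n : ℝ) : ℂ) z := by
    intro n
    induction n with
    | zero =>
      intro β h0 h1 z hz
      simpa using base_case A hAre h0 h1 hz
    | succ n ih =>
      intro β h0 h1 z hz
      have h := rec_step A hA hAre (b := β + n) ?_ (ih β h0 h1) hz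
      · have e : (β + n : ℝ) + 1 = β + ((n + 1 : ℕ) : ℝ) := by push_cast; ring
        rw [e] at h
        exact h
      · intro m hm
        have h2 : β = ((m - n : ℤ) : ℝ) := by push_cast; linarith
        rw [h2] at h0 h1
        have h3 : (0 : ℤ) < m - n := by exact_mod_cast h0
        have h4 : m - n < (1 : ℤ) := by exact_mod_cast h1
        omega
  have hfl : 0 ≤ ⌊b⌋ := Int.floor_nonneg.2 hb0.le
  obtain ⟨n, hn⟩ := Int.eq_ofNat_of_zero_le hfl
  have hfr : Int.fract b + n = b := by
    have := Int.fract_add_floor b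
    rw [hn] at this
    exact_mod_cast this
  have hpos : 0 < Int.fract b := by
    refine lt_of_le_of_ne (Int.fract_nonneg b) fun h => ?_
    apply hb ⌊b⌋
    have := Int.fract_add_floor b
    rw [← h] at this; linarith
  have := main n (Int.fract b) hpos (Int.fract_lt_one b) z hz
  rwa [hfr] at this

/-- the function `(1 - exp (-s)) / s` -/
def qf (s : ℂ) : ℂ := (1 - Complex.exp (-s)) / s

/-- the function `1 / (exp s - 1) - 1 / s + 1 / 2` -/
def pf (s : ℂ) : ℂ := 1 / (Complex.exp s - 1) - 1 / s + 1 / 2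

/-- the integrand after substitution -/
def Phi (z : ℝ) (A : ℂ) (b : ℝ) (w : ℂ) : ℂ :=
  Complex.exp (z / 2 - (z * Complex.exp (-w) + A * Complex.exp w) - z * pf (Complex.exp w)
    + (1 - b) * w) * (qf (Complex.exp w)) ^ (-(b : ℂ))

lemma exp_sub_one_norm (s : ℂ) : Real.exp s.re - 1 ≤ ‖Complex.exp s - 1‖ := by
  have := norm_sub_norm_le (Complex.exp s) 1
  rwa [Complex.norm_exp, norm_one] at this

lemma exp_sub_one_ne {s : ℂ} (hs : 0 < s.re) : Complex.exp s - 1 ≠ 0 := by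
  have h := exp_sub_one_norm s
  have h2 := Real.add_one_le_exp s.re
  have : 0 < ‖Complex.exp s - 1‖ := by linarith
  exact norm_pos_iff.1 this

lemma ne_zero_of_re {s : ℂ} (hs : 0 < s.re) : s ≠ 0 := by
  rintro rfl; simp at hs

lemma norm_le_two_re {s : ℂ} (hs2 : |s.im| ≤ s.re) : ‖s‖ ≤ 2 * s.re := by
  have := Complex.norm_le_abs_re_add_abs_im s
  have h : 0 ≤ s.re := (abs_nonneg _).trans hs2
  rw [abs_of_nonneg h] at this
  linarith

lemma qf_slit {s : ℂ} (hs : 0 < s.re) : qf s ∈ Complex.slitPlane := by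
  rw [Complex.mem_slitPlane_iff_not_le_zero]
  intro h
  have hs0 := ne_zero_of_re hs
  have h1 : 1 - Complex.exp (-s) = qf s * s := by unfold qf; field_simp
  have h2 : qf s = ((qf s).re : ℂ) := by
    apply Complex.ext
    · simp
    · simpa using (Complex.le_def.1 h).2
  have hre : (qf s).re ≤ 0 := (Complex.le_def.1 h).1
  rw [h2] at h1
  have h3 := congrArg Complex.re h1
  rw [Complex.re_ofReal_mul] at h3
  have h4 : (Complex.exp (-s)).re < 1 := by
    calc (Complex.exp (-s)).re ≤ ‖Complex.exp (-s)‖ := Complex.re_le_norm _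
      _ = Real.exp (-s.re) := by rw [Complex.norm_exp]; simp
      _ < 1 := by rw [Real.exp_lt_one_iff]; linarith
  simp only [Complex.sub_re, Complex.one_re] at h3
  nlinarith

lemma qf_norm_ge {s : ℂ} (hs : 0 < s.re) (hs2 : |s.im| ≤ s.re) : 1 / (2 * (1 + ‖s‖)) ≤ ‖qf s‖ := by
  have hs0 := ne_zero_of_re hs
  have hn : 0 < ‖s‖ := norm_pos_iff.2 hs0
  have h1 : 1 - Real.exp (-s.re) ≤ ‖1 - Complex.exp (-s)‖ := by
    have := norm_sub_norm_le 1 (Complex.exp (-s))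
    rwa [Complex.norm_exp, norm_one, Complex.neg_re] at this
  have h2 : Real.exp (-s.re) ≤ 1 / (1 + s.re) := by
    rw [Real.exp_neg, ← one_div]
    apply one_div_le_one_div_of_le (by linarith)
    linarith [Real.add_one_le_exp s.re]
  have h3 := norm_le_two_re hs2
  have h4 : s.re ≤ ‖s‖ := Complex.re_le_norm s
  have h5 : s.re / (1 + s.re) ≤ 1 - Real.exp (-s.re) := by
    have : s.re / (1 + s.re) = 1 - 1 / (1 + s.re) := by field_simp; ring
    linarith
  unfold qf
  rw [norm_div, div_le_div_iff₀ (by positivity) hn]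
  have h6 : s.re / (1 + s.re) ≤ ‖1 - Complex.exp (-s)‖ := h5.trans h1
  rw [div_le_iff₀ (by linarith)] at h6
  have h7 : 0 ≤ ‖1 - Complex.exp (-s)‖ := norm_nonneg _
  nlinarith

lemma qf_cpow_norm {s : ℂ} (hs : 0 < s.re) (hs2 : |s.im| ≤ s.re) {b : ℝ} (hb : 0 ≤ b) :
    ‖(qf s) ^ (-(b : ℂ))‖ ≤ (2 * (1 + ‖s‖)) ^ b := by
  have hq := qf_norm_ge hs hs2
  have hpos : 0 < 2 * (1 + ‖s‖) := by positivity
  have hq0 : qf s ≠ 0 := Complex.slitPlane_ne_zero (qf_slit hs)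
  have e : ‖(qf s) ^ (-(b : ℂ))‖ = ‖qf s‖ ^ (-b) := by
    rw [← Complex.ofReal_neg]
    exact Complex.norm_cpow_real _ _
  rw [e, Real.rpow_neg (norm_nonneg _), ← Real.inv_rpow (norm_nonneg _)]
  apply Real.rpow_le_rpow (by positivity) _ hb
  rw [← one_div]
  have := one_div_le_one_div_of_le (by positivity) hq
  simpa using this

lemma qf_sub_one {s : ℂ} (hs : s ≠ 0) (h1 : ‖s‖ ≤ 1) : ‖qf s - 1‖ ≤ ‖s‖ := by
  have h := Complex.norm_exp_sub_one_sub_id_le (x := -s) (by rwa [norm_neg])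
  have e : qf s - 1 = -(Complex.exp (-s) - 1 - -s) / s := by
    unfold qf; field_simp; ring
  rw [e, norm_div, norm_neg, div_le_iff₀ (norm_pos_iff.2 hs)]
  rw [norm_neg] at h
  nlinarith

lemma pf_small {s : ℂ} (hs : 0 < s.re) (hs2 : |s.im| ≤ s.re) (h1 : ‖s‖ ≤ 1) : ‖pf s‖ ≤ 2 * ‖s‖ := by
  have hs0 := ne_zero_of_re hs
  have he := exp_sub_one_ne hs
  have hn : 0 < ‖s‖ := norm_pos_iff.2 hs0
  have hb := Complex.exp_bound h1 (n := 3) (by norm_num)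
  simp only [Finset.sum_range_succ, Finset.sum_range_zero, Nat.factorial] at hb
  norm_num at hb
  set R := Complex.exp s - (1 + s + s ^ 2 / 2) with hR
  have e : pf s = (s ^ 3 / 2 + (s - 2) * R) / (2 * s * (Complex.exp s - 1)) := by
    unfold pf
    field_simp
    rw [hR]; ring
  have hden : ‖s‖ ^ 2 ≤ ‖2 * s * (Complex.exp s - 1)‖ := by
    rw [norm_mul, norm_mul]
    have h2 := exp_sub_one_norm s
    have h3 := Real.add_one_le_exp s.re
    have h4 := norm_le_two_re hs2
    simp only [Complex.norm_ofNat]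
    nlinarith
  have hnum : ‖s ^ 3 / 2 + (s - 2) * R‖ ≤ 2 * ‖s‖ ^ 3 := by
    have h2 : ‖s - 2‖ ≤ 3 := by
      have := norm_sub_le s 2
      simp only [Complex.norm_ofNat] at this
      linarith
    calc _ ≤ ‖s ^ 3 / 2‖ + ‖(s - 2) * R‖ := norm_add_le _ _
      _ = ‖s‖ ^ 3 / 2 + ‖s - 2‖ * ‖R‖ := by rw [norm_div, norm_pow, norm_mul]; simp
      _ ≤ ‖s‖ ^ 3 / 2 + 3 * (‖s‖ ^ 3 * (2 / 9)) := by gcongr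
      _ ≤ _ := by nlinarith [pow_pos hn 3]
  rw [e, norm_div]
  calc _ ≤ 2 * ‖s‖ ^ 3 / ‖s‖ ^ 2 := by gcongr
    _ = 2 * ‖s‖ := by field_simp

lemma pf_bound {s : ℂ} (hs : 0 < s.re) (hs2 : |s.im| ≤ s.re) : ‖pf s‖ ≤ 4 := by
  rcases le_total ‖s‖ 1 with h | h
  · linarith [pf_small hs hs2 h]
  · have h2 := exp_sub_one_norm s
    have h3 := Real.add_one_le_exp s.re
    have h4 := norm_le_two_re hs2
    have h5 : (1 / 2 : ℝ) ≤ ‖Complex.exp s - 1‖ := by linarith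
    unfold pf
    calc _ ≤ ‖1 / (Complex.exp s - 1)‖ + ‖1 / s‖ + ‖(1 / 2 : ℂ)‖ :=
          (norm_add_le _ _).trans (by gcongr; exact norm_sub_le _ _)
      _ = 1 / ‖Complex.exp s - 1‖ + 1 / ‖s‖ + 1 / 2 := by simp
      _ ≤ 1 / (1 / 2) + 1 / 1 + 1 / 2 := by gcongr
      _ ≤ 4 := by norm_num

lemma exp_sector {w : ℂ} (hw : |w.im| ≤ Real.pi / 4) :
    0 < (Complex.exp w).re ∧ |(Complex.exp w).im| ≤ (Complex.exp w).re := by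
  rw [Complex.exp_re, Complex.exp_im]
  have hp := Real.pi_pos
  have h := abs_le.1 hw
  have hc : 0 < Real.cos w.im := Real.cos_pos_of_mem_Ioo ⟨by linarith, by linarith⟩
  refine ⟨by positivity, ?_⟩
  rw [abs_mul, abs_of_pos (Real.exp_pos _)]
  apply mul_le_mul_of_nonneg_left _ (Real.exp_pos _).le
  rw [abs_le]
  constructor
  · have h1 := Real.cos_nonneg_of_mem_Icc (x := w.im - Real.pi / 4) ⟨by linarith, by linarith⟩
    rw [Real.cos_sub, Real.cos_pi_div_four, Real.sin_pi_div_four] at h1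
    have : 0 < √2 / 2 := by positivity
    nlinarith
  · have h1 := Real.cos_nonneg_of_mem_Icc (x := w.im + Real.pi / 4) ⟨by linarith, by linarith⟩
    rw [Real.cos_add, Real.cos_pi_div_four, Real.sin_pi_div_four] at h1
    have : 0 < √2 / 2 := by positivity
    nlinarith

lemma phi_bound {z : ℝ} (hz : 0 ≤ z) (A : ℂ) {b : ℝ} (hb : 0 ≤ b) {w : ℂ}
    (hw : |w.im| ≤ Real.pi / 4) :
    ‖Phi z A b w‖ ≤ Real.exp (5 * z) * Real.exp (-(z * Complex.exp (-w) + A * Complex.exp w).re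
      + (1 - b) * w.re) * (2 * (1 + Real.exp w.re)) ^ b := by
  obtain ⟨h1, h2⟩ := exp_sector hw
  unfold Phi
  rw [norm_mul, Complex.norm_exp, ← Real.exp_add]
  have h3 := qf_cpow_norm h1 h2 hb
  rw [Complex.norm_exp] at h3
  apply mul_le_mul _ h3 (norm_nonneg _) (Real.exp_pos _).le
  apply Real.exp_le_exp.2
  have h4 := (Complex.abs_re_le_norm _).trans (pf_bound h1 h2)
  have h5 := (abs_le.1 h4).1
  have e1 : ((z : ℂ) / 2).re = z / 2 := by
    rw [show (z : ℂ) / 2 = ((z / 2 : ℝ) : ℂ) by push_cast; rfl, Complex.ofReal_re]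
  have e2 : ((1 - b : ℂ) * w).re = (1 - b) * w.re := by
    rw [show (1 - b : ℂ) = ((1 - b : ℝ) : ℂ) by push_cast; rfl, Complex.re_ofReal_mul]
  rw [Complex.add_re, Complex.sub_re, Complex.sub_re, e1, e2, Complex.re_ofReal_mul]
  nlinarith

lemma qf_diff {s : ℂ} (hs : s ≠ 0) : DifferentiableAt ℂ qf s := by
  unfold qf; fun_prop (disch := assumption)

lemma pf_diff {s : ℂ} (hs : 0 < s.re) : DifferentiableAt ℂ pf s := by
  have h0 := ne_zero_of_re hs
  have h1 := exp_sub_one_ne hs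
  unfold pf; fun_prop (disch := assumption)

lemma phi_diff (z : ℝ) (A : ℂ) (b : ℝ) {w : ℂ}
    (hw : |w.im| ≤ Real.pi / 4) : DifferentiableAt ℂ (Phi z A b) w := by
  obtain ⟨h1, h2⟩ := exp_sector hw
  have hE : DifferentiableAt ℂ Complex.exp w := Complex.differentiableAt_exp
  have hq : DifferentiableAt ℂ (fun w => qf (Complex.exp w)) w :=
    (qf_diff (ne_zero_of_re h1)).comp w hE
  have hp : DifferentiableAt ℂ (fun w => pf (Complex.exp w)) w :=
    (pf_diff h1).comp w hE
  have hq2 : DifferentiableAt ℂ (fun w => (qf (Complex.exp w)) ^ (-(b : ℂ))) w :=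
    hq.cpow (differentiableAt_const _) (qf_slit h1)
  unfold Phi
  fun_prop

lemma ofReal_exp_cpow (r : ℝ) (c : ℂ) : ((Real.exp r : ℝ) : ℂ) ^ c = Complex.exp (r * c) := by
  rw [Complex.cpow_def_of_ne_zero (by exact_mod_cast (Real.exp_pos r).ne'), ← Complex.ofReal_log
    (Real.exp_pos r).le, Real.log_exp]

lemma one_lt_exp_exp (x : ℝ) : 0 < Real.exp (Real.exp x) - 1 := by
  have h1 := Real.exp_pos x
  have h2 := Real.add_one_le_exp (Real.exp x)
  linarith

lemma subst_pointwise (z : ℝ) (A : ℂ) (b x : ℝ) :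
    |(-(Real.exp (Real.exp x) * Real.exp x) / (Real.exp (Real.exp x) - 1) ^ 2 : ℝ)| •
      (Complex.exp (-(z * (Real.exp (Real.exp x) - 1)⁻¹ : ℝ)) *
        (((Real.exp (Real.exp x) - 1)⁻¹ : ℝ) : ℂ) ^ (A - 1) *
        ((1 + (Real.exp (Real.exp x) - 1)⁻¹ : ℝ) : ℂ) ^ ((b : ℂ) - A - 1)) = Phi z A b x := by
  have hE := one_lt_exp_exp x
  set s := Real.exp x with hs
  set M := Real.log (Real.exp s - 1) with hM
  have hexpM : Real.exp M = Real.exp s - 1 := Real.exp_log hE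
  have hsp : 0 < s := Real.exp_pos x
  have e1 : |(-(Real.exp s * s) / (Real.exp s - 1) ^ 2 : ℝ)| = Real.exp (s + x - 2 * M) := by
    rw [neg_div, abs_neg, abs_of_pos (by positivity), ← hexpM, Real.exp_sub, Real.exp_add, ← hs,
      two_mul, Real.exp_add, sq]
  have e2 : (Real.exp s - 1)⁻¹ = Real.exp (-M) := by rw [Real.exp_neg, hexpM]
  have e3 : 1 + (Real.exp s - 1)⁻¹ = Real.exp (s - M) := by
    rw [Real.exp_sub, hexpM]; field_simp; ring
  have e4 : qf (Complex.exp x) = ((Real.exp (M - s - x) : ℝ) : ℂ) := by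
    rw [Real.exp_sub, Real.exp_sub, hexpM, ← hs]
    unfold qf
    rw [← Complex.ofReal_exp, ← hs, ← Complex.ofReal_neg, ← Complex.ofReal_exp]
    rw [Real.exp_neg]
    have : Real.exp s ≠ 0 := (Real.exp_pos s).ne'
    push_cast
    have : Complex.exp s ≠ 0 := Complex.exp_ne_zero _
    field_simp
  have e5 : pf (Complex.exp x) = (((Real.exp s - 1)⁻¹ - s⁻¹ + 1 / 2 : ℝ) : ℂ) := by
    unfold pf
    rw [← Complex.ofReal_exp, ← hs, ← Complex.ofReal_exp]
    push_cast
    simp only [one_div]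
  have e6 : Complex.exp (-(x : ℂ)) = ((s⁻¹ : ℝ) : ℂ) := by
    rw [hs, ← Real.exp_neg]; push_cast; rfl
  unfold Phi
  rw [e4, e5, e6, ofReal_exp_cpow, e1, e3, e2, ofReal_exp_cpow, ofReal_exp_cpow,
    Complex.real_smul, Complex.ofReal_exp, ← Complex.ofReal_exp x, ← hs, ← Complex.exp_add,
    ← Complex.exp_add, ← Complex.exp_add, ← Complex.exp_add]
  congr 1
  push_cast
  ring

lemma li_subst (z : ℝ) (A : ℂ) (b : ℝ) :
    LI A ((b : ℂ) - A - 1) z = ∫ x : ℝ, Phi z A b x := by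
  set f : ℝ → ℝ := fun x => (Real.exp (Real.exp x) - 1)⁻¹ with hf
  have hd : ∀ x ∈ (univ : Set ℝ), HasDerivWithinAt f
      (-(Real.exp (Real.exp x) * Real.exp x) / (Real.exp (Real.exp x) - 1) ^ 2) univ x := by
    intro x _
    exact (((Real.hasDerivAt_exp x).exp.sub_const 1).inv (one_lt_exp_exp x).ne').hasDerivWithinAt
  have hinj : InjOn f univ := by
    intro x _ y _ h
    simp only [hf, inv_inj, sub_left_inj] at h
    exact Real.exp_injective (Real.exp_injective h)
  have himg : f '' univ = Ioi 0 := by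
    ext t
    simp only [image_univ, mem_range, mem_Ioi]
    constructor
    · rintro ⟨x, rfl⟩; exact inv_pos.2 (one_lt_exp_exp x)
    · intro ht
      refine ⟨Real.log (Real.log (1 + t⁻¹)), ?_⟩
      have h1 : 0 < t⁻¹ := inv_pos.2 ht
      have h2 : 0 < Real.log (1 + t⁻¹) := Real.log_pos (by linarith)
      simp only [hf]
      rw [Real.exp_log h2, Real.exp_log (by linarith)]
      simp
  unfold LI
  rw [← himg, integral_image_eq_integral_abs_deriv_smul MeasurableSet.univ hd hinj]
  rw [setIntegral_univ]
  congr 1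
  funext x
  have := subst_pointwise z A b x
  simp only [hf]
  rw [← this]

/-- Moving the line of integration. -/
lemma shift_line {f : ℂ → ℂ} {g : ℝ → ℝ} {θ : ℝ}
    (hd : ∀ w : ℂ, w.im ∈ uIcc 0 θ → DifferentiableAt ℂ f w)
    (hb : ∀ x y : ℝ, y ∈ uIcc 0 θ → ‖f (x + y * Complex.I)‖ ≤ g x)
    (hg : Integrable g) (hg1 : Tendsto g atTop (𝓝 0)) (hg2 : Tendsto g atBot (𝓝 0)) :
    (∫ x : ℝ, f x) = ∫ x : ℝ, f (x + θ * Complex.I) := by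
  have hintg : ∀ y ∈ uIcc 0 θ, Integrable (fun x : ℝ => f (x + y * Complex.I)) := by
    intro y hy
    refine hg.mono' ?_ (Eventually.of_forall fun x => hb x y hy)
    apply Continuous.aestronglyMeasurable
    rw [continuous_iff_continuousAt]
    intro x
    have h1 : ContinuousAt f (x + y * Complex.I) := (hd _ (by simpa using hy)).continuousAt
    have h2 : ContinuousAt (fun x : ℝ => (x : ℂ) + y * Complex.I) x := by fun_prop
    exact ContinuousAt.comp (f := fun x : ℝ => (x : ℂ) + y * Complex.I) h1 h2
  have i0 := hintg 0 left_mem_uIcc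
  have i1 := hintg θ right_mem_uIcc
  simp only [Complex.ofReal_zero, zero_mul, add_zero] at i0
  have t0 := intervalIntegral_tendsto_integral i0 tendsto_neg_atTop_atBot tendsto_id
  have t1 := intervalIntegral_tendsto_integral i1 tendsto_neg_atTop_atBot tendsto_id
  have v : ∀ R : ℝ, ‖∫ y in (0 : ℝ)..θ, f (R + y * Complex.I)‖ ≤ g R * |θ - 0| := by
    intro R
    apply intervalIntegral.norm_integral_le_of_norm_le_const
    intro y hy
    exact hb R y (uIoc_subset_uIcc hy)
  have v1 : Tendsto (fun R : ℝ => ∫ y in (0 : ℝ)..θ, f (R + y * Complex.I)) atTop (𝓝 0) := by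
    apply squeeze_zero_norm v
    simpa using hg1.mul_const |θ - 0|
  have v2 : Tendsto (fun R : ℝ => ∫ y in (0 : ℝ)..θ, f (((-R : ℝ) : ℂ) + y * Complex.I)) atTop
      (𝓝 0) := by
    apply squeeze_zero_norm fun R => v (-R)
    simpa using (hg2.comp tendsto_neg_atTop_atBot).mul_const |θ - 0|
  have key : ∀ R : ℝ, (∫ x in (-R)..R, f x) = (∫ x in (-R)..R, f (x + θ * Complex.I))
      - Complex.I * (∫ y in (0 : ℝ)..θ, f (R + y * Complex.I))
      + Complex.I * (∫ y in (0 : ℝ)..θ, f (((-R : ℝ) : ℂ) + y * Complex.I)) := by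
    intro R
    have h := Complex.integral_boundary_rect_eq_zero_of_differentiableOn f
      ((-R : ℝ) : ℂ) (R + θ * Complex.I) (by
        intro w hw
        apply (hd w _).differentiableWithinAt
        have := hw.2
        simpa using this)
    simp at h
    push_cast
    linear_combination h
  have t2 := ((t1.sub (v1.const_mul Complex.I)).add (v2.const_mul Complex.I))
  simp only [mul_zero, sub_zero, add_zero] at t2
  refine tendsto_nhds_unique t0 (t2.congr fun R => ?_)
  exact (key R).symm

lemma two_add_sq_le (x : ℝ) : 2 + x ^ 2 ≤ Real.exp x + Real.exp (-x) := by
  have hc : ∀ t : ℝ, 0 ≤ t → 2 + t ^ 2 ≤ Real.exp t + Real.exp (-t) := by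
    intro t ht
    have h1 := Real.self_le_sinh_iff.2 (by positivity : 0 ≤ t / 2)
    have h2 := Real.cosh_sq' (t / 2)
    have h3 := Real.cosh_two_mul (t / 2)
    rw [show 2 * (t / 2) = t by ring, Real.cosh_eq] at h3
    have h4 : (t / 2) ^ 2 ≤ Real.sinh (t / 2) ^ 2 := by gcongr
    nlinarith
  rcases le_total 0 x with h | h
  · exact hc x h
  · have := hc (-x) (by linarith)
    rw [neg_neg] at this
    nlinarith

lemma gauss_bd {c : ℝ} (hc : 0 < c) (m x : ℝ) :
    Real.exp (-c * x ^ 2 + m * |x|) ≤ Real.exp (m ^ 2 / (2 * c)) * Real.exp (-(c / 2) * x ^ 2) := by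
  rw [← Real.exp_add]
  apply Real.exp_le_exp.2
  have h : 0 ≤ (m - c * |x|) ^ 2 / (2 * c) := by positivity
  have e : (m - c * |x|) ^ 2 / (2 * c) = m ^ 2 / (2 * c) - m * |x| + c / 2 * x ^ 2 := by
    rw [← sq_abs x]; field_simp; ring
  nlinarith

lemma pow_part {x X b : ℝ} (hb : 0 ≤ b) (hX : X ≤ x) :
    Real.exp ((1 - b) * x) * (2 * (1 + Real.exp X)) ^ b ≤ 4 ^ b * Real.exp ((1 + 2 * b) * |x|) := by
  have h1 : 2 * (1 + Real.exp X) ≤ 4 * Real.exp |x| := by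
    have a1 : Real.exp X ≤ Real.exp |x| := Real.exp_le_exp.2 (hX.trans (le_abs_self x))
    have a2 : 1 ≤ Real.exp |x| := Real.one_le_exp (abs_nonneg x)
    linarith
  have h2 : (2 * (1 + Real.exp X)) ^ b ≤ 4 ^ b * Real.exp (b * |x|) := by
    calc _ ≤ (4 * Real.exp |x|) ^ b := by gcongr
      _ = _ := by rw [Real.mul_rpow (by norm_num) (Real.exp_pos _).le, ← Real.exp_mul, mul_comm b]
  have h3 : Real.exp ((1 - b) * x) ≤ Real.exp ((1 + b) * |x|) := by
    apply Real.exp_le_exp.2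
    calc (1 - b) * x ≤ |(1 - b) * x| := le_abs_self _
      _ = |1 - b| * |x| := abs_mul _ _
      _ ≤ (1 + b) * |x| := by
        gcongr
        rw [abs_le]; constructor <;> linarith
  calc _ ≤ Real.exp ((1 + b) * |x|) * (4 ^ b * Real.exp (b * |x|)) := by gcongr
    _ = 4 ^ b * (Real.exp ((1 + b) * |x|) * Real.exp (b * |x|)) := by ring
    _ = _ := by rw [← Real.exp_add]; ring_nf

lemma cos_ge_half {y : ℝ} (hy : |y| ≤ Real.pi / 4) : 1 / 2 ≤ Real.cos y := by
  have hp := Real.pi_pos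
  rw [← Real.cos_abs]
  calc (1 / 2 : ℝ) = Real.cos (Real.pi / 3) := by rw [Real.cos_pi_div_three]
    _ ≤ _ := Real.cos_le_cos_of_nonneg_of_le_pi (abs_nonneg _) (by linarith) (by linarith)

lemma re_main {z : ℝ} (A : ℂ) (x y : ℝ) :
    (z * Complex.exp (-(x + y * Complex.I)) + A * Complex.exp (x + y * Complex.I)).re =
      z * (Real.exp (-x) * Real.cos y) + (A.re * (Real.exp x * Real.cos y)
        - A.im * (Real.exp x * Real.sin y)) := by
  simp [Complex.exp_re, Complex.exp_im, Complex.mul_re]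

lemma phi_line_bound {z : ℝ} (hz : 0 < z) {A : ℂ} (hA : 0 < A.re) (hA2 : 0 ≤ A.im) {b : ℝ}
    (hb : 0 ≤ b) {x y : ℝ} (hy : |y| ≤ Real.pi / 4) (hy0 : y ≤ 0) :
    ‖Phi z A b (x + y * Complex.I)‖ ≤ Real.exp (5 * z) * (4 ^ b *
      (Real.exp ((1 + 2 * b) ^ 2 / (2 * (min z A.re / 2))) *
        Real.exp (-(min z A.re / 2 / 2) * x ^ 2))) := by
  set c := min z A.re / 2 with hc
  have hc0 : 0 < c := by rw [hc]; have := lt_min hz hA; positivity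
  have h := phi_bound hz.le A hb (w := x + y * Complex.I) (by simpa using hy)
  have hre : ((x : ℂ) + y * Complex.I).re = x := by simp
  rw [re_main, hre] at h
  refine h.trans ?_
  rw [mul_assoc]
  apply mul_le_mul_of_nonneg_left _ (Real.exp_pos _).le
  have hcos := cos_ge_half hy
  have hsin : Real.sin y ≤ 0 := Real.sin_nonpos_of_nonpos_of_neg_pi_le hy0
    (by have := (abs_le.1 hy).1; have := Real.pi_pos; linarith)
  have e1 := Real.exp_pos x
  have e2 := Real.exp_pos (-x)
  have k1 : c * Real.exp (-x) ≤ z * (Real.exp (-x) * Real.cos y) := by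
    have : c ≤ z * Real.cos y := by
      have := min_le_left z A.re
      nlinarith
    nlinarith
  have k2 : c * Real.exp x ≤ A.re * (Real.exp x * Real.cos y) := by
    have : c ≤ A.re * Real.cos y := by
      have := min_le_right z A.re
      nlinarith
    nlinarith
  have k3 : A.im * (Real.exp x * Real.sin y) ≤ 0 := by
    have : Real.exp x * Real.sin y ≤ 0 := by nlinarith
    nlinarith
  have k4 := two_add_sq_le x
  have hp := pow_part (x := x) (X := x) hb le_rfl
  have hgb := gauss_bd hc0 (1 + 2 * b) x
  rw [Real.exp_add, mul_assoc]
  calc _ ≤ Real.exp (-c * x ^ 2) * (4 ^ b * Real.exp ((1 + 2 * b) * |x|)) := by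
        gcongr
        nlinarith
    _ = 4 ^ b * Real.exp (-c * x ^ 2 + (1 + 2 * b) * |x|) := by rw [Real.exp_add]; ring
    _ ≤ _ := by gcongr

lemma gauss_tendsto {c : ℝ} (hc : 0 < c) (C : ℝ) :
    Tendsto (fun x : ℝ => C * Real.exp (-c * x ^ 2)) atTop (𝓝 0) ∧
    Tendsto (fun x : ℝ => C * Real.exp (-c * x ^ 2)) atBot (𝓝 0) := by
  have h0 : Tendsto (fun x : ℝ => C * Real.exp (-c * x ^ 2)) atTop (𝓝 0) := by
    have h1 : Tendsto (fun x : ℝ => -(c * x ^ 2)) atTop atBot :=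
      tendsto_neg_atTop_atBot.comp ((tendsto_pow_atTop two_ne_zero).const_mul_atTop hc)
    have := (Real.tendsto_exp_atBot.comp h1).const_mul C
    simpa [Function.comp_def] using this
  refine ⟨h0, ?_⟩
  have := h0.comp tendsto_neg_atBot_atTop
  simpa [Function.comp_def] using this

lemma phi_rotate {z : ℝ} (hz : 0 < z) {A : ℂ} (hA : 0 < A.re) (hA2 : 0 ≤ A.im) {b : ℝ}
    (hb : 0 ≤ b) :
    (∫ x : ℝ, Phi z A b x) =
      ∫ x : ℝ, Phi z A b (x + ((Real.log z : ℂ) - Complex.log A) / 2) := by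
  have harg : Complex.arg A ∈ Icc 0 (Real.pi / 2) := by
    refine ⟨Complex.arg_nonneg_iff.2 hA2, ?_⟩
    exact (abs_le.1 (Complex.abs_arg_le_pi_div_two_iff.2 hA.le)).2
  set θ : ℝ := -(Complex.arg A / 2) with hθ
  have hu : ∀ y ∈ uIcc 0 θ, |y| ≤ Real.pi / 4 ∧ y ≤ 0 := by
    intro y hy
    rw [uIcc_of_ge (by rw [hθ]; linarith [harg.1])] at hy
    have h1 := hy.1
    have h2 := hy.2
    have h3 := harg.2
    refine ⟨?_, h2⟩
    rw [abs_le]; constructor <;> linarith [Real.pi_pos]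
  have hc0 : 0 < min z A.re / 2 / 2 := by have := lt_min hz hA; positivity
  set C := Real.exp (5 * z) * (4 ^ b * Real.exp ((1 + 2 * b) ^ 2 / (2 * (min z A.re / 2))))
  have hs := shift_line (f := Phi z A b)
    (g := fun x => C * Real.exp (-(min z A.re / 2 / 2) * x ^ 2)) (θ := θ)
    (fun w hw => phi_diff z A b (hu _ hw).1)
    (fun x y hy => (phi_line_bound hz hA hA2 hb (hu y hy).1 (hu y hy).2).trans (by
      apply le_of_eq; ring))
    ((integrable_exp_neg_mul_sq hc0).const_mul C)
    (gauss_tendsto hc0 C).1 (gauss_tendsto hc0 C).2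
  rw [hs, ← integral_add_right_eq_self (fun x : ℝ => Phi z A b (x + θ * Complex.I))
    ((Real.log z - Real.log ‖A‖) / 2)]
  congr 1
  funext x
  congr 1
  rw [Complex.log, hθ]
  push_cast
  ring

/-- saddle point location -/
def ell (z : ℝ) (A : ℂ) : ℂ := ((Real.log z : ℂ) - Complex.log A) / 2

/-- the large parameter -/
def lam (z : ℝ) (A : ℂ) : ℂ := Complex.exp (((Real.log z : ℂ) + Complex.log A) / 2)

/-- the rescaled normalised integrand -/
def Gf (z : ℝ) (A : ℂ) (b y : ℝ) : ℂ :=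
  Complex.exp (2 * lam z A - (1 - b) * ell z A - z / 2) *
    Phi z A b (((y / √‖lam z A‖ : ℝ) : ℂ) + ell z A)

lemma lam_ne (z : ℝ) (A : ℂ) : lam z A ≠ 0 := Complex.exp_ne_zero _

lemma ell_re (z : ℝ) (A : ℂ) : (ell z A).re = (Real.log z - Real.log ‖A‖) / 2 := by
  unfold ell; simp [Complex.log_re]

lemma ell_im (z : ℝ) (A : ℂ) : (ell z A).im = -(Complex.arg A / 2) := by
  unfold ell; simp [Complex.log_im]; ring

lemma lam_norm (z : ℝ) (A : ℂ) : ‖lam z A‖ = Real.exp ((Real.log z + Real.log ‖A‖) / 2) := by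
  unfold lam; rw [Complex.norm_exp]; simp [Complex.log_re]

lemma lam_re (z : ℝ) (A : ℂ) : (lam z A).re = ‖lam z A‖ * Real.cos (Complex.arg A / 2) := by
  rw [lam_norm]; unfold lam; rw [Complex.exp_re]; simp [Complex.log_re, Complex.log_im]

lemma lam_eq (z : ℝ) (A : ℂ) :
    lam z A = ‖lam z A‖ * Complex.exp ((Complex.arg A / 2 : ℝ) * Complex.I) := by
  rw [lam_norm, Complex.ofReal_exp, ← Complex.exp_add]
  unfold lam Complex.log
  congr 1; push_cast; ring

lemma arg_mem {A : ℂ} (hA : 0 ≤ A.re) (hA2 : 0 ≤ A.im) : Complex.arg A ∈ Icc 0 (Real.pi / 2) :=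
  ⟨Complex.arg_nonneg_iff.2 hA2, (abs_le.1 (Complex.abs_arg_le_pi_div_two_iff.2 hA)).2⟩

lemma ell_sector {z : ℝ} {A : ℂ} (hA : 0 ≤ A.re) (hA2 : 0 ≤ A.im) (x : ℝ) :
    |((x : ℂ) + ell z A).im| ≤ Real.pi / 4 := by
  have := arg_mem hA hA2
  have h1 := this.1
  have h2 := this.2
  rw [Complex.add_im, Complex.ofReal_im, zero_add, ell_im, abs_neg, abs_le]
  constructor <;> linarith [Real.pi_pos]

lemma gf_eq {z : ℝ} (hz : 0 < z) {A : ℂ} (hA : A ≠ 0) (b y : ℝ) :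
    Gf z A b y = Complex.exp (-(lam z A * ((Real.exp (y / √‖lam z A‖) +
        Real.exp (-(y / √‖lam z A‖)) - 2 : ℝ) : ℂ))
      - z * pf (Complex.exp (((y / √‖lam z A‖ : ℝ) : ℂ) + ell z A))
      + (1 - b) * ((y / √‖lam z A‖ : ℝ) : ℂ)) *
      (qf (Complex.exp (((y / √‖lam z A‖ : ℝ) : ℂ) + ell z A))) ^ (-(b : ℂ)) := by
  unfold Gf Phi
  set x : ℝ := y / √‖lam z A‖
  have h1 : (z : ℂ) * Complex.exp (-(x + ell z A)) = lam z A * Complex.exp (-x) := by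
    have e : (z : ℂ) = Complex.exp (Real.log z : ℝ) := by
      rw [← Complex.ofReal_exp, Real.exp_log hz]
    have e' : (z : ℂ) * Complex.exp (-(x + ell z A)) =
        Complex.exp (Real.log z : ℝ) * Complex.exp (-(x + ell z A)) := by rw [← e]
    rw [e']
    unfold lam ell
    rw [← Complex.exp_add, ← Complex.exp_add]
    congr 1; ring
  have h2 : A * Complex.exp (x + ell z A) = lam z A * Complex.exp x := by
    have e : A * Complex.exp (x + ell z A) = Complex.exp (Complex.log A) * Complex.exp (x + ell z A)
      := by rw [Complex.exp_log hA]
    rw [e]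
    unfold lam ell
    rw [← Complex.exp_add, ← Complex.exp_add]
    congr 1; ring
  rw [h1, h2, ← mul_assoc, ← Complex.exp_add]
  congr 2
  push_cast
  ring

lemma gf_bound {z Z : ℝ} (hz : 0 < z) (hZ : z ≤ Z) {A : ℂ} (hA : 0 < A.re) (hA2 : 0 ≤ A.im)
    {b : ℝ} (hb : 0 ≤ b) (h1 : 1 ≤ ‖lam z A‖) (h2 : (ell z A).re ≤ 0) (y : ℝ) :
    ‖Gf z A b y‖ ≤ Real.exp (4 * Z) * 4 ^ b * Real.exp ((1 + 2 * b) ^ 2 / (2 * (1 / 2)))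
      * Real.exp (-(1 / 2 / 2) * y ^ 2) := by
  have hA0 : A ≠ 0 := ne_zero_of_re hA
  rw [gf_eq hz hA0, norm_mul, Complex.norm_exp]
  have hsq : 1 ≤ √‖lam z A‖ := Real.one_le_sqrt.2 h1
  set x : ℝ := y / √‖lam z A‖ with hx
  have hxy : |x| ≤ |y| := by
    rw [hx, abs_div, abs_of_pos (by linarith : 0 < √‖lam z A‖)]
    exact div_le_self (abs_nonneg _) hsq
  have hx2 : ‖lam z A‖ * x ^ 2 = y ^ 2 := by
    rw [hx, div_pow, Real.sq_sqrt (norm_nonneg _)]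
    field_simp
  obtain ⟨s1, s2⟩ := exp_sector (ell_sector (z := z) hA.le hA2 x)
  have hq := qf_cpow_norm s1 s2 hb
  have hp := (abs_le.1 ((Complex.abs_re_le_norm _).trans (pf_bound s1 s2))).1
  rw [Complex.norm_exp, Complex.add_re, Complex.ofReal_re] at hq
  set s := Complex.exp ((x : ℂ) + ell z A)
  have e2 : ((1 - b : ℂ) * x).re = (1 - b) * x := by
    rw [show (1 - b : ℂ) = ((1 - b : ℝ) : ℂ) by push_cast; rfl, Complex.re_ofReal_mul,
      Complex.ofReal_re]
  rw [Complex.add_re, Complex.sub_re, Complex.neg_re, Complex.re_mul_ofReal, Complex.re_ofReal_mul,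
    e2]
  have hcos : 1 / 2 ≤ Real.cos (Complex.arg A / 2) := by
    apply cos_ge_half
    have := arg_mem hA.le hA2
    have t1 := this.1
    have t2 := this.2
    rw [abs_le]; constructor <;> linarith [Real.pi_pos]
  have hlr : ‖lam z A‖ / 2 ≤ (lam z A).re := by
    rw [lam_re]
    nlinarith
  have k1 : y ^ 2 / 2 ≤ (lam z A).re * (Real.exp x + Real.exp (-x) - 2) := by
    have t := two_add_sq_le x
    calc y ^ 2 / 2 = ‖lam z A‖ / 2 * x ^ 2 := by rw [← hx2]; ring
      _ ≤ _ := by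
        apply mul_le_mul hlr (by linarith) (sq_nonneg _) (le_trans (by positivity) hlr)
  have k2 : -(z * (pf s).re) ≤ 4 * Z := by nlinarith
  have k3 := pow_part (x := x) (X := x + (ell z A).re) hb (by linarith)
  have k4 : Real.exp ((1 + 2 * b) * |x|) ≤ Real.exp ((1 + 2 * b) * |y|) := by gcongr
  have k5 := gauss_bd (c := 1 / 2) (by norm_num) (1 + 2 * b) y
  calc _ ≤ Real.exp (4 * Z + -(1 / 2) * y ^ 2 + (1 - b) * x) *
        (2 * (1 + Real.exp (x + (ell z A).re))) ^ b := by
        apply mul_le_mul _ hq (norm_nonneg _) (Real.exp_pos _).le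
        apply Real.exp_le_exp.2
        linarith
    _ = Real.exp (4 * Z) * Real.exp (-(1 / 2) * y ^ 2) * (Real.exp ((1 - b) * x) *
        (2 * (1 + Real.exp (x + (ell z A).re))) ^ b) := by
        rw [Real.exp_add, Real.exp_add]; ring
    _ ≤ Real.exp (4 * Z) * Real.exp (-(1 / 2) * y ^ 2) * (4 ^ b * Real.exp ((1 + 2 * b) * |y|)) := by
        apply mul_le_mul_of_nonneg_left _ (by positivity)
        exact k3.trans (mul_le_mul_of_nonneg_left k4 (by positivity))
    _ = Real.exp (4 * Z) * 4 ^ b * Real.exp (-(1 / 2) * y ^ 2 + (1 + 2 * b) * |y|) := by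
        rw [Real.exp_add]; ring
    _ ≤ Real.exp (4 * Z) * 4 ^ b * (Real.exp ((1 + 2 * b) ^ 2 / (2 * (1 / 2)))
      * Real.exp (-(1 / 2 / 2) * y ^ 2)) := by gcongr
    _ = _ := by ring

lemma gf_cont (z : ℝ) {A : ℂ} (hA : 0 ≤ A.re) (hA2 : 0 ≤ A.im) (b : ℝ) :
    Continuous (Gf z A b) := by
  unfold Gf
  apply Continuous.mul continuous_const
  rw [continuous_iff_continuousAt]
  intro y
  have h1 := (phi_diff z A b (ell_sector (z := z) hA hA2 (y / √‖lam z A‖))).continuousAt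
  have h2 : ContinuousAt (fun y : ℝ => ((y / √‖lam z A‖ : ℝ) : ℂ) + ell z A) y := by fun_prop
  exact ContinuousAt.comp (f := fun y : ℝ => ((y / √‖lam z A‖ : ℝ) : ℂ) + ell z A) h1 h2

lemma gf_integral {z : ℝ} (hz : 0 < z) {A : ℂ} (hA : 0 < A.re) (hA2 : 0 ≤ A.im) {b : ℝ}
    (hb : 0 ≤ b) :
    (∫ y : ℝ, Gf z A b y) = Complex.exp (2 * lam z A - (1 - b) * ell z A - z / 2) *
      (√‖lam z A‖ : ℂ) * LI A ((b : ℂ) - A - 1) z := by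
  rw [li_subst, phi_rotate hz hA hA2 hb]
  unfold Gf
  rw [integral_const_mul]
  have := Measure.integral_comp_div (fun x : ℝ => Phi z A b (x + ell z A)) (√‖lam z A‖)
  rw [this, abs_of_nonneg (Real.sqrt_nonneg _), Complex.real_smul, mul_assoc]
  rfl

lemma cosh_limit {ι : Type*} {l : Filter ι} {L : ι → ℝ} (hL : Tendsto L l atTop) (y : ℝ) :
    Tendsto (fun i => L i * (Real.exp (y / √(L i)) + Real.exp (-(y / √(L i))) - 2)) l
      (𝓝 (y ^ 2)) := by
  have hr : Tendsto (fun i => (√(L i))⁻¹) l (𝓝[≠] 0) := by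
    have h1 : Tendsto (fun i => √(L i)) l atTop := Real.tendsto_sqrt_atTop.comp hL
    have h2 := tendsto_inv_atTop_nhdsGT_zero.comp h1
    refine h2.mono_right (nhdsWithin_mono _ ?_)
    intro x hx
    exact (ne_of_gt hx)
  have hd : HasDerivAt (fun r : ℝ => 2 * Real.sinh (r * (y / 2))) y 0 := by
    have h := ((hasDerivAt_mul_const (x := (0 : ℝ)) (y / 2)).sinh).const_mul 2
    refine h.congr_deriv ?_
    simp; ring
  have h1 := (hd.tendsto_slope_zero.comp hr).pow 2
  refine h1.congr' ?_
  filter_upwards [hL.eventually_gt_atTop 0] with i hi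
  have hs : 0 < √(L i) := Real.sqrt_pos.2 hi
  simp only [Function.comp_def, zero_add, zero_mul, Real.sinh_zero, mul_zero, sub_zero, smul_eq_mul,
    inv_inv]
  have e1 : Real.exp (y / √(L i)) + Real.exp (-(y / √(L i))) - 2 =
      4 * Real.sinh ((√(L i))⁻¹ * (y / 2)) ^ 2 := by
    have h3 := Real.cosh_two_mul ((√(L i))⁻¹ * (y / 2))
    have h2 := Real.cosh_sq' ((√(L i))⁻¹ * (y / 2))
    rw [show 2 * ((√(L i))⁻¹ * (y / 2)) = y / √(L i) by field_simp, Real.cosh_eq] at h3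
    linarith
  rw [e1]
  nth_rewrite 3 [← Real.sq_sqrt hi.le]
  ring

lemma gf_pointwise {ι : Type*} {l : Filter ι} {z : ι → ℝ} {A : ι → ℂ} {Z b : ℝ}
    (hz : ∀ᶠ i in l, 0 < z i ∧ z i ≤ Z) (hA : ∀ᶠ i in l, 0 < (A i).re ∧ 0 ≤ (A i).im)
    (harg : Tendsto (fun i => Complex.arg (A i)) l (𝓝 (Real.pi / 2)))
    (hL : Tendsto (fun i => ‖lam (z i) (A i)‖) l atTop)
    (hl : Tendsto (fun i => (ell (z i) (A i)).re) l atBot) (y : ℝ) :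
    Tendsto (fun i => Gf (z i) (A i) b y) l
      (𝓝 (Complex.exp (-Complex.exp ((Real.pi / 4 : ℝ) * Complex.I) * (y : ℂ) ^ 2))) := by
  have hx : Tendsto (fun i => y / √‖lam (z i) (A i)‖) l (𝓝 0) :=
    (Real.tendsto_sqrt_atTop.comp hL).const_div_atTop y
  have hxc : Tendsto (fun i => ((y / √‖lam (z i) (A i)‖ : ℝ) : ℂ)) l (𝓝 0) := by
    have := (Complex.continuous_ofReal.tendsto 0).comp hx
    rw [Complex.ofReal_zero] at this
    exact this
  set s : ι → ℂ := fun i => Complex.exp (((y / √‖lam (z i) (A i)‖ : ℝ) : ℂ) + ell (z i) (A i))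
    with hs
  have hsn : Tendsto (fun i => ‖s i‖) l (𝓝 0) := by
    have h1 := Real.tendsto_exp_atBot.comp (hx.add_atBot hl)
    refine h1.congr fun i => ?_
    simp only [hs, Complex.norm_exp, Complex.add_re, Complex.ofReal_re, Function.comp_def]
  have hs1 : ∀ᶠ i in l, ‖s i‖ ≤ 1 := (hsn.eventually_lt_const one_pos).mono fun i h => h.le
  have hsec : ∀ᶠ i in l, 0 < (s i).re ∧ |(s i).im| ≤ (s i).re := by
    filter_upwards [hA] with i hi
    exact exp_sector (ell_sector hi.1.le hi.2 _)
  have hq : Tendsto (fun i => qf (s i)) l (𝓝 1) := by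
    rw [tendsto_iff_norm_sub_tendsto_zero]
    refine squeeze_zero' (Eventually.of_forall fun i => norm_nonneg _) ?_ hsn
    filter_upwards [hs1] with i h1
    exact qf_sub_one (Complex.exp_ne_zero _) h1
  have hq2 : Tendsto (fun i => qf (s i) ^ (-(b : ℂ))) l (𝓝 1) := by
    have := hq.cpow (tendsto_const_nhds (x := -(b : ℂ))) (by simp)
    simpa using this
  have hp : Tendsto (fun i => (z i : ℂ) * pf (s i)) l (𝓝 0) := by
    apply squeeze_zero_norm' (a := fun i => Z * (2 * ‖s i‖))
    · filter_upwards [hs1, hsec, hz] with i h1 h2 h3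
      rw [norm_mul, Complex.norm_real, Real.norm_of_nonneg h3.1.le]
      exact mul_le_mul h3.2 (pf_small h2.1 h2.2 h1) (norm_nonneg _) (h3.1.le.trans h3.2)
    · simpa using (hsn.const_mul 2).const_mul Z
  have hc := cosh_limit hL y
  have hcc := (Complex.continuous_ofReal.tendsto _).comp hc
  have he : Tendsto (fun i => Complex.exp ((Complex.arg (A i) / 2 : ℝ) * Complex.I)) l
      (𝓝 (Complex.exp ((Real.pi / 4 : ℝ) * Complex.I))) := by
    have hcont : Continuous (fun t : ℝ => Complex.exp ((t / 2 : ℝ) * Complex.I)) := by fun_prop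
    have := (hcont.tendsto (Real.pi / 2)).comp harg
    rw [show Real.pi / 2 / 2 = Real.pi / 4 by ring] at this
    exact this
  have h1 := (((he.mul hcc).neg.sub hp).add (hxc.const_mul (1 - b : ℂ))).cexp.mul hq2
  simp only [sub_zero, mul_zero, add_zero, mul_one] at h1
  have e : Complex.exp (-Complex.exp ((Real.pi / 4 : ℝ) * Complex.I) * (y : ℂ) ^ 2) =
      Complex.exp (-(Complex.exp ((Real.pi / 4 : ℝ) * Complex.I) * ((y ^ 2 : ℝ) : ℂ))) := by
    congr 1; push_cast; ring
  rw [e]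
  refine h1.congr' ?_
  filter_upwards [hz, hA] with i h2 h3
  rw [gf_eq h2.1 (ne_zero_of_re h3.1)]
  congr 4
  simp only [Function.comp_def, Complex.ofReal_mul]
  linear_combination ((Real.exp (y / √‖lam (z i) (A i)‖) +
    Real.exp (-(y / √‖lam (z i) (A i)‖)) - 2 : ℝ) : ℂ) * lam_eq (z i) (A i)

lemma gf_limit {ι : Type*} {l : Filter ι} [l.IsCountablyGenerated] {z : ι → ℝ} {A : ι → ℂ}
    {Z b : ℝ} (hb : 0 ≤ b)
    (hz : ∀ᶠ i in l, 0 < z i ∧ z i ≤ Z) (hA : ∀ᶠ i in l, 0 < (A i).re ∧ 0 ≤ (A i).im)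
    (harg : Tendsto (fun i => Complex.arg (A i)) l (𝓝 (Real.pi / 2)))
    (hL : Tendsto (fun i => ‖lam (z i) (A i)‖) l atTop)
    (hl : Tendsto (fun i => (ell (z i) (A i)).re) l atBot) :
    Tendsto (fun i => ∫ y : ℝ, Gf (z i) (A i) b y) l
      (𝓝 ((√Real.pi : ℂ) * Complex.exp (-((Real.pi / 8 : ℝ) * Complex.I)))) := by
  have hlim : (∫ y : ℝ, Complex.exp (-Complex.exp ((Real.pi / 4 : ℝ) * Complex.I) * (y : ℂ) ^ 2)) =
      (√Real.pi : ℂ) * Complex.exp (-((Real.pi / 8 : ℝ) * Complex.I)) := by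
    rw [integral_gaussian_complex (by
      rw [Complex.exp_ofReal_mul_I_re, Real.cos_pi_div_four]; positivity)]
    have e : (Real.pi : ℂ) / Complex.exp ((Real.pi / 4 : ℝ) * Complex.I) =
        Complex.exp ((Real.log Real.pi : ℝ) - (Real.pi / 4 : ℝ) * Complex.I) := by
      rw [Complex.exp_sub, ← Complex.ofReal_exp, Real.exp_log Real.pi_pos]
    have e' : (√Real.pi : ℂ) = Complex.exp ((Real.log Real.pi / 2 : ℝ)) := by
      rw [← Complex.ofReal_exp, Real.exp_half, Real.exp_log Real.pi_pos]
    have him : ((Real.log Real.pi : ℝ) - (Real.pi / 4 : ℝ) * Complex.I : ℂ).im = -(Real.pi / 4) := by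
      rw [Complex.sub_im, Complex.ofReal_im, Complex.im_ofReal_mul, Complex.I_im]; ring
    rw [e, Complex.cpow_def_of_ne_zero (Complex.exp_ne_zero _), Complex.log_exp
      (by rw [him]; linarith [Real.pi_pos]) (by rw [him]; linarith [Real.pi_pos]), e',
      ← Complex.exp_add]
    congr 1; push_cast; ring
  rw [← hlim]
  refine tendsto_integral_filter_of_dominated_convergence
    (fun y => Real.exp (4 * Z) * 4 ^ b * Real.exp ((1 + 2 * b) ^ 2 / (2 * (1 / 2)))
      * Real.exp (-(1 / 2 / 2) * y ^ 2)) ?_ ?_ ?_ ?_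
  · filter_upwards [hA] with i h
    exact (gf_cont _ h.1.le h.2 b).aestronglyMeasurable
  · filter_upwards [hz, hA, hL.eventually_ge_atTop 1, hl.eventually_le_atBot 0] with i h1 h2 h3 h4
    exact Eventually.of_forall fun y => gf_bound h1.1 h1.2 h2.1 h2.2 hb h3 h4 y
  · exact (integrable_exp_neg_mul_sq (by norm_num)).const_mul _
  · exact Eventually.of_forall fun y => gf_pointwise hz hA harg hL hl y

lemma ratio_eq {z : ℝ} (hz : 0 < z) {A : ℂ} (hA : 0 < A.re) (hA2 : 0 < A.im) {b : ℝ}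
    (hb0 : 0 < b) (hb : ∀ m : ℤ, b ≠ m) :
    tricomiU A b z / (((√Real.pi : ℂ) / Complex.Gamma A) *
      Complex.exp (z / 2 - 2 * (((z : ℂ) * A) ^ ((1 : ℂ) / 2))) *
      ((z : ℂ) ^ ((1 : ℂ) / 4 - b / 2)) * (A ^ (-(3 : ℂ) / 4 + b / 2))) =
    (∫ y : ℝ, Gf z A b y) * Complex.exp ((Complex.arg A / 4 : ℝ) * Complex.I) / (√Real.pi : ℂ) := by
  have hA0 : A ≠ 0 := ne_zero_of_re hA
  have hzc : (z : ℂ) ≠ 0 := by exact_mod_cast hz.ne'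
  have hG : Complex.Gamma A ≠ 0 := Complex.Gamma_ne_zero_of_re_pos hA
  have hpi : (√Real.pi : ℂ) ≠ 0 := by
    exact_mod_cast (Real.sqrt_pos.2 Real.pi_pos).ne'
  have hlz : Complex.log (z : ℂ) = (Real.log z : ℝ) := (Complex.ofReal_log hz.le).symm
  have e1 : ((z : ℂ) * A) ^ ((1 : ℂ) / 2) = lam z A := by
    rw [Complex.cpow_def_of_ne_zero (mul_ne_zero hzc hA0), Complex.log_ofReal_mul hz hA0]
    unfold lam
    congr 1; ring
  have e2 : (√‖lam z A‖ : ℂ) = Complex.exp (((Real.log z : ℝ) + (Real.log ‖A‖ : ℝ)) / 4) := by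
    rw [lam_norm, ← Real.exp_half, Complex.ofReal_exp]
    congr 1; push_cast; ring
  rw [gf_integral hz hA hA2.le hb0.le, gamma_mul_tricomi A hA2.ne' hA hb0 hb hz, e1, e2,
    Complex.cpow_def_of_ne_zero hzc, Complex.cpow_def_of_ne_zero hA0, hlz]
  have e3 : Complex.exp (2 * lam z A - (1 - b) * ell z A - z / 2) *
      Complex.exp (((Real.log z : ℝ) + (Real.log ‖A‖ : ℝ)) / 4) *
      Complex.exp ((Complex.arg A / 4 : ℝ) * Complex.I) *
      (Complex.exp (z / 2 - 2 * lam z A) * Complex.exp ((Real.log z : ℝ) * ((1 : ℂ) / 4 - b / 2)) *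
      Complex.exp (Complex.log A * (-(3 : ℂ) / 4 + b / 2))) = 1 := by
    rw [← Complex.exp_add, ← Complex.exp_add, ← Complex.exp_add, ← Complex.exp_add,
      ← Complex.exp_add]
    refine Eq.trans (congrArg Complex.exp ?_) Complex.exp_zero
    unfold ell Complex.log
    push_cast
    ring
  have n1 := Complex.exp_ne_zero (z / 2 - 2 * lam z A)
  have n2 := Complex.exp_ne_zero ((Real.log z : ℝ) * ((1 : ℂ) / 4 - b / 2))
  have n3 := Complex.exp_ne_zero (Complex.log A * (-(3 : ℂ) / 4 + b / 2))
  generalize Complex.exp (z / 2 - 2 * lam z A) = E1 at *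
  generalize Complex.exp ((Real.log z : ℝ) * ((1 : ℂ) / 4 - b / 2)) = E2 at *
  generalize Complex.exp (Complex.log A * (-(3 : ℂ) / 4 + b / 2)) = E3 at *
  rw [div_eq_div_iff (by positivity) hpi]
  generalize Complex.exp (2 * lam z A - (1 - b) * ell z A - z / 2) = E4 at *
  generalize Complex.exp (((Real.log z : ℝ) + (Real.log ‖A‖ : ℝ)) / 4) = E5 at *
  generalize Complex.exp ((Complex.arg A / 4 : ℝ) * Complex.I) = E6 at *
  field_simp
  linear_combination (-(tricomiU A b z)) * e3

lemma compact_bounds {K : Set ℝ} (hK : IsCompact K) (hKpos : K ⊆ Set.Ioi 0) :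
    ∃ m M : ℝ, 0 < m ∧ ∀ v ∈ K, m ≤ v ∧ v ≤ M := by
  rcases K.eq_empty_or_nonempty with rfl | hne
  · exact ⟨1, 1, one_pos, by simp⟩
  · obtain ⟨m, hm⟩ := hK.exists_isLeast hne
    obtain ⟨M, hM⟩ := hK.exists_isGreatest hne
    exact ⟨m, M, hKpos hm.1, fun v hv => ⟨hm.2 hv, hM.2 hv⟩⟩

lemma main_tendsto {κ d b : ℝ} (hκ : 0 < κ) (hd : 0 < d) (hb0 : 0 < b) (hb : ∀ m : ℤ, b ≠ m)
    (j : ℕ) {K : Set ℝ} (hK : IsCompact K) (hKpos : K ⊆ Set.Ioi 0) :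
    Tendsto (fun q : ℝ × ℝ =>
      tricomiU ((1 + q.1 * Complex.I) / κ + j) b ((d * q.2 : ℝ) : ℂ) /
      (((√Real.pi : ℂ) / Complex.Gamma ((1 + q.1 * Complex.I) / κ + j)) *
      Complex.exp (((d * q.2 : ℝ) : ℂ) / 2 -
        2 * ((((d * q.2 : ℝ) : ℂ) * ((1 + q.1 * Complex.I) / κ + j)) ^ ((1 : ℂ) / 2))) *
      ((((d * q.2 : ℝ) : ℂ) : ℂ) ^ ((1 : ℂ) / 4 - b / 2)) *
      (((1 + q.1 * Complex.I) / κ + j) ^ (-(3 : ℂ) / 4 + b / 2))))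
      (atTop ×ˢ 𝓟 K) (𝓝 1) := by
  obtain ⟨m, M, hm, hmM⟩ := compact_bounds hK hKpos
  set l : Filter (ℝ × ℝ) := atTop ×ˢ 𝓟 K with hl
  set A : ℝ × ℝ → ℂ := fun q => (1 + q.1 * Complex.I) / κ + j with hAdef
  set z : ℝ × ℝ → ℝ := fun q => d * q.2 with hzdef
  have hAre : ∀ q, (A q).re = 1 / κ + j := by
    intro q; simp [hAdef, Complex.div_ofReal_re]
  have hAim : ∀ q, (A q).im = q.1 / κ := by
    intro q; simp [hAdef, Complex.div_ofReal_im]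
  have hr : 0 < 1 / κ + (j : ℝ) := by positivity
  have hfst : Tendsto (fun q : ℝ × ℝ => q.1) l atTop := tendsto_fst
  have hsnd : ∀ᶠ q in l, q.2 ∈ K := tendsto_snd (f := atTop) (mem_principal_self K)
  have hz : ∀ᶠ q in l, d * m ≤ z q ∧ z q ≤ d * M := by
    filter_upwards [hsnd] with q hq
    have := hmM q.2 hq
    exact ⟨by simp only [hzdef]; gcongr; exact this.1, by simp only [hzdef]; gcongr; exact this.2⟩
  have hdm : 0 < d * m := by positivity
  have hz' : ∀ᶠ q in l, 0 < z q ∧ z q ≤ d * M := by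
    filter_upwards [hz] with q hq
    exact ⟨by linarith [hq.1], hq.2⟩
  have hA : ∀ᶠ q in l, 0 < (A q).re ∧ 0 < (A q).im := by
    filter_upwards [hfst.eventually_gt_atTop 0] with q hq
    rw [hAre, hAim]
    exact ⟨hr, by positivity⟩
  have hA' : ∀ᶠ q in l, 0 < (A q).re ∧ 0 ≤ (A q).im := hA.mono fun q h => ⟨h.1, h.2.le⟩
  have hn : Tendsto (fun q => ‖A q‖) l atTop := by
    refine tendsto_atTop_mono (fun q => Complex.im_le_norm (A q)) ?_
    simp only [hAim]
    exact hfst.atTop_div_const hκ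
  have hlog : Tendsto (fun q => Real.log ‖A q‖) l atTop := Real.tendsto_log_atTop.comp hn
  have harg : Tendsto (fun q => Complex.arg (A q)) l (𝓝 (Real.pi / 2)) := by
    have h1 : Tendsto (fun q => (1 / κ + (j : ℝ)) / ‖A q‖) l (𝓝 0) := hn.const_div_atTop _
    have h2 := (Real.continuous_arccos.tendsto 0).comp h1
    rw [Real.arccos_zero] at h2
    refine h2.congr' ?_
    filter_upwards [hA] with q hq
    rw [Complex.arg_of_im_nonneg_of_ne_zero hq.2.le (ne_zero_of_re hq.1), hAre]
    rfl
  have hL : Tendsto (fun q => ‖lam (z q) (A q)‖) l atTop := by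
    simp only [lam_norm]
    refine Real.tendsto_exp_atTop.comp ?_
    refine Tendsto.atTop_div_const two_pos ?_
    refine tendsto_atTop_mono' l ?_ (tendsto_atTop_add_const_left l (Real.log (d * m)) hlog)
    filter_upwards [hz] with q hq
    have := Real.log_le_log hdm hq.1
    linarith
  have hl' : Tendsto (fun q => (ell (z q) (A q)).re) l atBot := by
    simp only [ell_re]
    refine Tendsto.atBot_div_const two_pos ?_
    refine tendsto_atBot_mono' l ?_ (tendsto_atBot_add_const_left l (Real.log (d * M))
      (tendsto_neg_atTop_atBot.comp hlog))
    filter_upwards [hz'] with q hq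
    have := Real.log_le_log hq.1 hq.2
    simp only [Function.comp_def]
    linarith
  have : l.IsCountablyGenerated := by rw [hl]; infer_instance
  have hlim := gf_limit hb0.le hz' hA' harg hL hl'
  have he : Tendsto (fun q => Complex.exp ((Complex.arg (A q) / 4 : ℝ) * Complex.I)) l
      (𝓝 (Complex.exp ((Real.pi / 8 : ℝ) * Complex.I))) := by
    have hcont : Continuous (fun t : ℝ => Complex.exp ((t / 4 : ℝ) * Complex.I)) := by fun_prop
    have := (hcont.tendsto (Real.pi / 2)).comp harg
    rw [show Real.pi / 2 / 4 = Real.pi / 8 by ring] at this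
    exact this
  have hfin := (hlim.mul he).div_const (√Real.pi : ℂ)
  have hpi : (√Real.pi : ℂ) ≠ 0 := by
    exact_mod_cast (Real.sqrt_pos.2 Real.pi_pos).ne'
  have e1 : (√Real.pi : ℂ) * Complex.exp (-((Real.pi / 8 : ℝ) * Complex.I)) *
      Complex.exp ((Real.pi / 8 : ℝ) * Complex.I) / (√Real.pi : ℂ) = 1 := by
    rw [mul_assoc, ← Complex.exp_add, neg_add_cancel, Complex.exp_zero, mul_one, div_self hpi]
  rw [e1] at hfin
  refine hfin.congr' ?_
  filter_upwards [hz', hA] with q h1 h2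
  exact (ratio_eq h1.1 h2.1 h2.2 hb0 hb).symm

end helpers

/-- Equation (4.9): uniform asymptotics of the Tricomi function along the upper
imaginary direction, uniformly for `v` in a compact subset of `(0, ∞)`. -/
theorem tricomi_asymptotics_upper
    (a σ κ : ℝ) (ha : 0 < a) (hσ : 0 < σ) (hκ : 0 < κ)
    (hnotint : ∀ m : ℤ, 2 * a / σ ^ 2 ≠ (m : ℝ))
    (j : ℕ) (hj : j ≤ 1)
    (K : Set ℝ) (hK : IsCompact K) (hKpos : K ⊆ Set.Ioi 0) :
    TendstoUniformlyOn
      (fun (u : ℝ) (v : ℝ) =>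
        tricomiU ((1 + u * Complex.I) / κ + j) (2 * a / σ ^ 2 + j)
            ((2 * κ * v / σ ^ 2 : ℝ) : ℂ) /
          (((Real.sqrt Real.pi : ℂ) / Complex.Gamma ((1 + u * Complex.I) / κ + j)) *
            Complex.exp (((κ * v / σ ^ 2 : ℝ) : ℂ) -
              2 * ((((2 * κ * v / σ ^ 2 : ℝ) : ℂ) * ((1 + u * Complex.I) / κ + j))
                ^ ((1 : ℂ) / 2))) *
            (((2 * κ * v / σ ^ 2 : ℝ) : ℂ)
              ^ (((1 : ℂ) / 4 - (a : ℂ) / (σ : ℂ) ^ 2 - (j : ℂ) / 2) : ℂ)) *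
            (((1 + u * Complex.I) / κ + j)
              ^ ((-(3 : ℂ) / 4 + (a : ℂ) / (σ : ℂ) ^ 2 + (j : ℂ) / 2) : ℂ))))
      (fun _ => 1) atTop K := by
  have hb0 : 0 < 2 * a / σ ^ 2 + (j : ℝ) := by positivity
  have hb : ∀ m : ℤ, 2 * a / σ ^ 2 + (j : ℝ) ≠ m := by
    intro m hm
    apply hnotint (m - j)
    push_cast; linarith
  have hd : 0 < 2 * κ / σ ^ 2 := by positivity
  have h := main_tendsto hκ hd hb0 hb j hK hKpos
  rw [Metric.tendstoUniformlyOn_iff]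
  intro ε hε
  have h2 := eventually_prod_principal_iff.1 (Metric.tendsto_nhds.1 h ε hε)
  filter_upwards [h2] with u hu v hv
  have h3 := hu v hv
  rw [dist_comm]
  have e1 : 2 * κ / σ ^ 2 * v = 2 * κ * v / σ ^ 2 := by ring
  have e2 : ((2 * κ * v / σ ^ 2 : ℝ) : ℂ) / 2 = ((κ * v / σ ^ 2 : ℝ) : ℂ) := by
    push_cast; ring
  have e3 : (((2 * a / σ ^ 2 + (j : ℝ) : ℝ)) : ℂ) = 2 * a / σ ^ 2 + j := by push_cast; ring
  have e4 : (1 : ℂ) / 4 - (2 * a / σ ^ 2 + j) / 2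
      = (1 : ℂ) / 4 - (a : ℂ) / (σ : ℂ) ^ 2 - (j : ℂ) / 2 := by ring
  have e5 : -(3 : ℂ) / 4 + (2 * a / σ ^ 2 + j) / 2
      = -(3 : ℂ) / 4 + (a : ℂ) / (σ : ℂ) ^ 2 + (j : ℂ) / 2 := by ring
  simp only [e1, e2, e3, e4, e5] at h3
  exact h3

end
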